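/- arXiv:1910.08843 — 2 statements merged into one kernel-verified Lean document; each statement's English description precedes it below -/
import Mathlib

section
/- For every integer k ≥ 2, every integer m ≥ 2, and every integer n with 3 ≤ n ≤ 2m+1, the symplectic group Sp(2m, F_{2^k}) over the finite field with 2^k elements has a string C-group representation of rank n. -/
/-- A string C-group representation of rank `n` of a group `G`: a family of `n`
involutions generating `G`, satisfying the commuting (string) property and the
intersection property. -/
def IsStringCGroupRep {G : Type*} [Group G] {n : ℕ} (ρ : Fin n → G) : Prop :=
  (∀ i, orderOf (ρ i) = 2) ∧
  Subgroup.closure (Set.range ρ) = ⊤ ∧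
  (∀ i j : Fin n, i.val + 1 < j.val → Commute (ρ i) (ρ j)) ∧
  (∀ I J : Set (Fin n),
    Subgroup.closure (ρ '' I) ⊓ Subgroup.closure (ρ '' J) = Subgroup.closure (ρ '' (I ∩ J)))

/-- The subgroup generated by the members of the family `ρ` with index in `S`. -/
def parabolic {G : Type*} [Group G] (ρ : ℕ → G) (S : Set ℕ) : Subgroup G :=
  Subgroup.closure (ρ '' S)

namespace parabolic

variable {G : Type*} [Group G] {ρ : ℕ → G}

theorem mem {S : Set ℕ} {k : ℕ} (hk : k ∈ S) : ρ k ∈ parabolic ρ S :=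
  Subgroup.subset_closure ⟨k, hk, rfl⟩

theorem mono {S T : Set ℕ} (h : S ⊆ T) : parabolic ρ S ≤ parabolic ρ T :=
  Subgroup.closure_mono (Set.image_mono h)

theorem le_of_forall {S : Set ℕ} {H : Subgroup G} (h : ∀ k ∈ S, ρ k ∈ H) :
    parabolic ρ S ≤ H := by
  refine (Subgroup.closure_le H).2 ?_
  rintro _ ⟨k, hk, rfl⟩
  exact h k hk

theorem empty : parabolic ρ ∅ = ⊥ := by
  simp [parabolic]

theorem commute {S T : Set ℕ} (h : ∀ i ∈ S, ∀ j ∈ T, Commute (ρ i) (ρ j)) {x y : G}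
    (hx : x ∈ parabolic ρ S) (hy : y ∈ parabolic ρ T) : Commute x y := by
  have h1 : parabolic ρ S ≤ Subgroup.centralizer (parabolic ρ T : Set G) := by
    refine le_of_forall fun i hi => ?_
    rw [Subgroup.mem_centralizer_iff]
    intro y hy
    have : parabolic ρ T ≤ Subgroup.centralizer {ρ i} := by
      refine le_of_forall fun j hj => ?_
      rw [Subgroup.mem_centralizer_singleton_iff]
      exact (h i hi j hj).symm.eq
    exact Subgroup.mem_centralizer_singleton_iff.1 (this hy)
  exact (Subgroup.mem_centralizer_iff.1 (h1 hx) y hy).symm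

theorem exists_mul_of_mem_union {S T : Set ℕ} (h : ∀ i ∈ S, ∀ j ∈ T, Commute (ρ i) (ρ j)) {x : G}
    (hx : x ∈ parabolic ρ (S ∪ T)) : ∃ y ∈ parabolic ρ S, ∃ z ∈ parabolic ρ T, x = y * z := by
  unfold parabolic at hx
  induction hx using Subgroup.closure_induction with
  | mem x hx =>
    obtain ⟨k, hk | hk, rfl⟩ := hx
    · exact ⟨_, mem hk, 1, one_mem _, by simp⟩
    · exact ⟨1, one_mem _, _, mem hk, by simp⟩
  | one => exact ⟨1, one_mem _, 1, one_mem _, by simp⟩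
  | mul x y _ _ hx hy =>
    obtain ⟨a, ha, b, hb, rfl⟩ := hx
    obtain ⟨c, hc, d, hd, rfl⟩ := hy
    refine ⟨a * c, mul_mem ha hc, b * d, mul_mem hb hd, ?_⟩
    have := (commute h hc hb).eq
    rw [mul_assoc, ← mul_assoc b, ← this]
    group
  | inv x _ hx =>
    obtain ⟨a, ha, b, hb, rfl⟩ := hx
    refine ⟨a⁻¹, inv_mem ha, b⁻¹, inv_mem hb, ?_⟩
    rw [(commute h ha hb).eq, mul_inv_rev]

theorem exists_mul_split {n : ℕ} (hcomm : ∀ i j, i + 1 < j → j < n → Commute (ρ i) (ρ j))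
    {I : Set ℕ} {a : ℕ} (hI : ∀ k ∈ I, k < n) (ha : a ∉ I) {x : G} (hx : x ∈ parabolic ρ I) :
    ∃ y ∈ parabolic ρ (I ∩ Set.Iio a), ∃ z ∈ parabolic ρ (I ∩ Set.Ioi a), x = y * z := by
  refine exists_mul_of_mem_union ?_ (mono ?_ hx)
  · rintro i ⟨_, hi⟩ j ⟨hj, hj'⟩
    simp only [Set.mem_Iio, Set.mem_Ioi] at hi hj'
    exact hcomm i j (by omega) (hI j hj)
  · intro k hk
    rcases lt_trichotomy k a with h | h | h
    · exact Or.inl ⟨hk, h⟩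
    · exact absurd (h ▸ hk) ha
    · exact Or.inr ⟨hk, h⟩

/-- The intersection property of a string group follows from its instances for pairs of
intervals of consecutive generators shifted by one. -/
theorem inf_le_of_intervals {n : ℕ} (hcomm : ∀ i j, i + 1 < j → j < n → Commute (ρ i) (ρ j))
    (h_inter : ∀ i j, i < j → j < n → parabolic ρ (Set.Ico i j) ⊓ parabolic ρ (Set.Ico (i + 1) (j + 1))
      ≤ parabolic ρ (Set.Ico (i + 1) j)) (d : ℕ) :
    ∀ i, i + d ≤ n → ∀ I J : Set ℕ, I ⊆ Set.Ico i (i + d) → J ⊆ Set.Ico i (i + d) →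
      parabolic ρ I ⊓ parabolic ρ J ≤ parabolic ρ (I ∩ J) := by
  induction d with
  | zero =>
    intro i _ I J hI _
    have : I = ∅ := by simpa using hI
    rw [this, empty]
    exact inf_le_left.trans bot_le
  | succ d ih =>
    intro i hi
    have hdn : i + d < n := by omega
    have hL := ih i (by omega)
    have hR := ih (i + 1) (by omega)
    have hs : parabolic ρ (Set.Ico i (i + d)) ⊓ parabolic ρ (Set.Ico (i + 1) (i + d + 1)) ≤
        parabolic ρ (Set.Ico (i + 1) (i + d)) := by
      rcases Nat.eq_zero_or_pos d with rfl | hd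
      · refine inf_le_left.trans ?_
        simp [empty]
      · exact h_inter i (i + d) (by omega) hdn
    have hI : ∀ k l, k ≤ i + d → i + 1 ≤ l → parabolic ρ (Set.Ico i k) ⊓
        parabolic ρ (Set.Ico l (i + d + 1)) ≤ parabolic ρ (Set.Ico l k) := by
      intro k l hk hl x hx
      have hx1 : x ∈ parabolic ρ (Set.Ico (i + 1) (i + d)) := by
        refine hs ⟨mono ?_ hx.1, mono ?_ hx.2⟩ <;> exact Set.Ico_subset_Ico (by omega) (by omega)
      have hx2 : x ∈ parabolic ρ (Set.Ico (i + 1) k) := by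
        refine mono ?_ (hL _ _ ?_ ?_ ⟨hx.1, hx1⟩) <;>
          intro m <;> simp only [Set.mem_inter_iff, Set.mem_Ico] <;> omega
      refine mono ?_ (hR _ _ ?_ ?_ ⟨hx2, hx.2⟩) <;>
          intro m <;> simp only [Set.mem_inter_iff, Set.mem_Ico] <;> omega
    have key : ∀ (I J : Set ℕ) (a b : ℕ), I ⊆ Set.Ico i (i + d + 1) → J ⊆ Set.Ico i (i + d + 1) →
        i ≤ a → a ≤ b → b ≤ i + d → a ∉ I → b ∉ J →
        parabolic ρ I ⊓ parabolic ρ J ≤ parabolic ρ (I ∩ J) := by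
      intro I J a b hIs hJs hia hab hb haI hbJ g hg
      have hIn : ∀ k ∈ I, i ≤ k ∧ k < i + d + 1 := fun k hk => hIs hk
      have hJn : ∀ k ∈ J, i ≤ k ∧ k < i + d + 1 := fun k hk => hJs hk
      obtain ⟨α, hα, α', hα', hgα⟩ := exists_mul_split hcomm
        (fun k hk => by have := hIn k hk; omega) haI hg.1
      obtain ⟨β, hβ, β', hβ', hgβ⟩ := exists_mul_split hcomm
        (fun k hk => by have := hJn k hk; omega) hbJ hg.2
      have hδ : β⁻¹ * α ∈ parabolic ρ (Set.Ico (a + 1) b) := by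
        refine hI b (a + 1) hb (by omega) (Subgroup.mem_inf.2 ⟨mul_mem (inv_mem ?_) ?_, ?_⟩)
        · refine mono ?_ hβ
          exact fun k hk => ⟨(hJn k hk.1).1, hk.2⟩
        · refine mono ?_ hα
          exact fun k hk => ⟨(hIn k hk.1).1, lt_of_lt_of_le hk.2 hab⟩
        · have : β⁻¹ * α = β' * α'⁻¹ := by
            rw [inv_mul_eq_iff_eq_mul, ← mul_assoc, ← hgβ, hgα, mul_inv_cancel_right]
          rw [this]
          refine mul_mem (mono ?_ hβ') (inv_mem (mono ?_ hα'))
          · exact fun k hk => ⟨by have := hk.2; simp only [Set.mem_Ioi] at this; omega,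
              (hJn k hk.1).2⟩
          · exact fun k hk => ⟨hk.2, (hIn k hk.1).2⟩
      have hα1 : α ∈ parabolic ρ ((I ∩ Set.Iio a) ∩ J) := by
        have h1 : α ∈ parabolic ρ (J ∩ Set.Iio b ∪ Set.Ico (a + 1) b) := by
          have : α = β * (β⁻¹ * α) := by group
          rw [this]
          exact mul_mem (mono Set.subset_union_left hβ) (mono Set.subset_union_right hδ)
        refine mono ?_ (hL _ _ ?_ ?_ ⟨hα, h1⟩)
        · rintro k ⟨hk, hk' | hk'⟩
          · exact ⟨hk, hk'.1⟩
          · have := hk.2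
            simp only [Set.mem_Iio, Set.mem_Ico] at this hk'
            omega
        · rintro k ⟨hk, hk'⟩
          simp only [Set.mem_Iio] at hk'
          exact ⟨(hIn k hk).1, by omega⟩
        · rintro k (⟨hk, hk'⟩ | hk')
          · simp only [Set.mem_Iio] at hk'
            exact ⟨(hJn k hk).1, by omega⟩
          · simp only [Set.mem_Ico] at hk' ⊢
            omega
      have hβ1 : β ∈ parabolic ρ ((I ∩ J ∩ Set.Iio a) ∪ (J ∩ Set.Ioi a)) := by
        have h1 : β ∈ parabolic ρ (I ∩ Set.Iio a ∪ Set.Ico (a + 1) b) := by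
          have : β = α * (β⁻¹ * α)⁻¹ := by group
          rw [this]
          exact mul_mem (mono Set.subset_union_left hα) (inv_mem (mono Set.subset_union_right hδ))
        refine mono ?_ (hL _ _ ?_ ?_ ⟨hβ, h1⟩)
        · rintro k ⟨hk, hk' | hk'⟩
          · exact Or.inl ⟨⟨hk'.1, hk.1⟩, hk'.2⟩
          · exact Or.inr ⟨hk.1, hk'.1⟩
        · rintro k ⟨hk, hk'⟩
          simp only [Set.mem_Iio] at hk'
          exact ⟨(hJn k hk).1, by omega⟩
        · rintro k (⟨hk, hk'⟩ | hk')
          · simp only [Set.mem_Iio] at hk'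
            exact ⟨(hIn k hk).1, by omega⟩
          · simp only [Set.mem_Ico] at hk' ⊢
            omega
      obtain ⟨β₁, hβ₁, β₂, hβ₂, rfl⟩ := exists_mul_of_mem_union (by
        rintro k ⟨_, hk⟩ l ⟨hl, hl'⟩
        simp only [Set.mem_Iio, Set.mem_Ioi] at hk hl'
        exact hcomm k l (by omega) (by have := hJn l hl; omega)) hβ1
      have hε : α⁻¹ * β₁ ∈ parabolic ρ (Set.Ico (a + 1) a) := by
        refine hI a (a + 1) (by omega) (by omega)
          (Subgroup.mem_inf.2 ⟨mul_mem (inv_mem (mono ?_ hα)) (mono ?_ hβ₁), ?_⟩)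
        · exact fun k hk => ⟨(hIn k hk.1).1, hk.2⟩
        · exact fun k hk => ⟨(hIn k hk.1.1).1, hk.2⟩
        · have : α⁻¹ * β₁ = α' * (β₂ * β')⁻¹ := by
            rw [inv_mul_eq_iff_eq_mul, ← mul_assoc, ← hgα, hgβ]
            group
          rw [this]
          refine mul_mem (mono ?_ hα') (inv_mem (mul_mem (mono ?_ hβ₂) (mono ?_ hβ')))
          · exact fun k hk => ⟨hk.2, (hIn k hk.1).2⟩
          · exact fun k hk => ⟨hk.2, (hJn k hk.1).2⟩
          · exact fun k hk => ⟨by have := hk.2; simp only [Set.mem_Ioi] at this; omega,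
              (hJn k hk.1).2⟩
      rw [Set.Ico_eq_empty (by omega), empty, Subgroup.mem_bot, inv_mul_eq_one] at hε
      subst hε
      have hα2 : α' = β₂ * β' := by
        have := hgα.symm.trans hgβ
        rwa [mul_assoc, mul_left_cancel_iff] at this
      have hα3 : α' ∈ parabolic ρ ((I ∩ Set.Ioi a) ∩ (J ∩ Set.Ioi a)) := by
        refine hR _ _ ?_ ?_ ⟨hα', ?_⟩
        · rintro k ⟨hk, hk'⟩
          have := hIn k hk
          simp only [Set.mem_Ioi] at hk'
          exact ⟨by omega, by omega⟩
        · rintro k ⟨hk, hk'⟩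
          have := hJn k hk
          simp only [Set.mem_Ioi] at hk'
          exact ⟨by omega, by omega⟩
        · rw [hα2]
          refine mul_mem hβ₂ (mono ?_ hβ')
          exact fun k hk => ⟨hk.1, lt_of_le_of_lt hab hk.2⟩
      rw [hgα]
      refine mul_mem (mono ?_ hα1) (mono ?_ hα3)
      · exact fun k hk => ⟨hk.1.1, hk.2⟩
      · exact fun k hk => ⟨hk.1.1, hk.2.1⟩
    intro I J hIs hJs
    by_cases h1 : Set.Ico i (i + d + 1) ⊆ I
    · rw [Set.inter_eq_right.2 (hJs.trans h1)]
      exact inf_le_right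
    by_cases h2 : Set.Ico i (i + d + 1) ⊆ J
    · rw [Set.inter_eq_left.2 (hIs.trans h2)]
      exact inf_le_left
    obtain ⟨a, ha, haI⟩ := Set.not_subset.1 h1
    obtain ⟨b, hb, hbJ⟩ := Set.not_subset.1 h2
    rw [Set.mem_Ico] at ha hb
    rcases le_total a b with hab | hab
    · exact key I J a b hIs hJs ha.1 hab (by omega) haI hbJ
    · rw [inf_comm, Set.inter_comm]
      exact key J I b a hJs hIs hb.1 hab (by omega) hbJ haI

end parabolic

/-- A string C-group with non-commuting neighbours in which all products of neighbouring
generators, apart from the first two, have odd order. -/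
structure IsOddStringCGroup {G : Type*} [Group G] (n : ℕ) (ρ : ℕ → G) : Prop where
  sq : ∀ i < n, ρ i * ρ i = 1
  gen : parabolic ρ (Set.Iio n) = ⊤
  comm : ∀ i j, i + 1 < j → j < n → Commute (ρ i) (ρ j)
  inter : ∀ I J : Set ℕ, I ⊆ Set.Iio n → J ⊆ Set.Iio n →
    parabolic ρ I ⊓ parabolic ρ J ≤ parabolic ρ (I ∩ J)
  noncomm : ∀ i, i + 1 < n → ¬ Commute (ρ i) (ρ (i + 1))
  odd : ∀ i, 2 ≤ i → i + 1 < n → ∃ p, (ρ (i + 1) * ρ i) ^ (2 * p + 1) = 1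

theorem commute_or_commute_mul_of_mem_closure_pair {G : Type*} [Group G] {s t x : G}
    (hs : s * s = 1) (ht : t * t = 1) (hx : x ∈ Subgroup.closure {s, t}) (hxt : Commute x t) :
    Commute x s ∨ Commute (x * t) s := by
  have key : Commute x (t * s) ∨ Commute (x * t) (t * s) := by
    have hs' : s⁻¹ = s := inv_eq_of_mul_eq_one_left hs
    have ht' : t⁻¹ = t := inv_eq_of_mul_eq_one_left ht
    have hst : Commute (s * t) (t * s) := by
      have : s * t = (t * s)⁻¹ := by rw [mul_inv_rev, hs', ht']
      rw [this]
      exact (Commute.refl _).inv_left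
    have step : ∀ x, (Commute x (t * s) ∨ Commute (x * t) (t * s)) →
        ∀ y ∈ ({s, t} : Set G), Commute (x * y) (t * s) ∨ Commute (x * y * t) (t * s) := by
      rintro x hx y (rfl | rfl)
      · rcases hx with h | h
        · right
          rw [mul_assoc]
          exact h.mul_left hst
        · left
          have : x * y = x * t * (t * y) := by
            rw [mul_assoc, ← mul_assoc t t, ht, one_mul]
          rw [this]
          exact h.mul_left (Commute.refl _)
      · rcases hx with h | h
        · right
          rwa [mul_assoc, ht, mul_one]
        · exact Or.inl h
    clear hxt
    induction hx using Subgroup.closure_induction_right with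
    | one => exact Or.inl (Commute.one_left _)
    | mul_right x _ y hy h => exact step x h y hy
    | mul_inv_cancel x _ y hy h =>
      have : y⁻¹ = y := by rcases hy with rfl | rfl <;> assumption
      rw [this]
      exact step x h y hy
  have hst : s = t * (t * s) := by rw [← mul_assoc, ht, one_mul]
  rcases key with h | h
  · left
    rw [hst]
    exact hxt.mul_right h
  · right
    rw [hst]
    exact (hxt.mul_left (Commute.refl _)).mul_right h

/-- The generators obtained by merging the first and the third member of a family. -/
def mergeFirst {G : Type*} [Group G] (ρ : ℕ → G) : ℕ → G
  | 0 => ρ 1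
  | 1 => ρ 0 * ρ 2
  | k + 2 => ρ (k + 3)

namespace IsOddStringCGroup

variable {G : Type*} [Group G] {n : ℕ} {ρ : ℕ → G}

theorem inv_eq (h : IsOddStringCGroup n ρ) {i : ℕ} (hi : i < n) : (ρ i)⁻¹ = ρ i :=
  inv_eq_of_mul_eq_one_left (h.sq i hi)

theorem eq_one_or_eq_of_mem_singleton (h : IsOddStringCGroup n ρ) {i : ℕ} (hi : i < n) {x : G}
    (hx : x ∈ parabolic ρ {i}) : x = 1 ∨ x = ρ i := by
  rw [parabolic, Set.image_singleton] at hx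
  induction hx using Subgroup.closure_induction with
  | mem x hx => exact Or.inr hx
  | one => exact Or.inl rfl
  | mul x y _ _ hx hy => rcases hx with rfl | rfl <;> rcases hy with rfl | rfl <;> simp [h.sq i hi]
  | inv x _ hx => rcases hx with rfl | rfl <;> simp [h.inv_eq hi]

theorem first_mem_mergeFirst (h : IsOddStringCGroup (n + 1) ρ) (hn : 3 ≤ n) {S : Set ℕ}
    (h1 : 1 ∈ S) (h2 : 2 ∈ S) : ρ 0 ∈ parabolic (mergeFirst ρ) S := by
  obtain ⟨p, hp⟩ := h.odd 2 le_rfl (by omega)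
  have hc : Commute (ρ 0) (ρ 3 * ρ 2) :=
    (h.comm 0 3 (by omega) (by omega)).mul_right (h.comm 0 2 (by omega) (by omega))
  have e : (mergeFirst ρ 2 * mergeFirst ρ 1) ^ (2 * p + 1) = ρ 0 := by
    have : mergeFirst ρ 2 * mergeFirst ρ 1 = ρ 0 * (ρ 3 * ρ 2) := by
      simp only [mergeFirst]
      rw [← mul_assoc, ← mul_assoc, (h.comm 0 3 (by omega) (by omega)).eq]
    rw [this, hc.mul_pow, hp, mul_one, pow_succ, pow_mul, pow_two, h.sq 0 (by omega), one_pow,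
      one_mul]
  rw [← e]
  exact pow_mem (mul_mem (parabolic.mem h2) (parabolic.mem h1)) _

theorem third_mem_mergeFirst (h : IsOddStringCGroup (n + 1) ρ) (hn : 3 ≤ n) {S : Set ℕ}
    (h1 : 1 ∈ S) (h2 : 2 ∈ S) : ρ 2 ∈ parabolic (mergeFirst ρ) S := by
  have : ρ 2 = ρ 0 * mergeFirst ρ 1 := by
    simp only [mergeFirst]
    rw [← mul_assoc, h.sq 0 (by omega), one_mul]
  rw [this]
  exact mul_mem (h.first_mem_mergeFirst hn h1 h2) (parabolic.mem h1)

theorem mergeFirst_le {S T : Set ℕ} (h0 : 0 ∈ S → 1 ∈ T) (h1 : 1 ∈ S → 0 ∈ T ∧ 2 ∈ T)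
    (hk : ∀ k, k + 2 ∈ S → k + 3 ∈ T) : parabolic (mergeFirst ρ) S ≤ parabolic ρ T := by
  refine parabolic.le_of_forall fun k hkS => ?_
  match k with
  | 0 => exact parabolic.mem (h0 hkS)
  | 1 => exact mul_mem (parabolic.mem (h1 hkS).1) (parabolic.mem (h1 hkS).2)
  | k + 2 => exact parabolic.mem (hk k hkS)

/-- Rank reduction. -/
theorem mergeFirst (h : IsOddStringCGroup (n + 1) ρ) (hn : 3 ≤ n) :
    IsOddStringCGroup n (mergeFirst ρ) := by
  have hc02 := h.comm 0 2 (by omega) (by omega)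
  have hsq1 : ρ 0 * ρ 2 * (ρ 0 * ρ 2) = 1 := by
    rw [← mul_assoc, mul_assoc (ρ 0), ← hc02.eq, ← mul_assoc, h.sq 0 (by omega), one_mul,
      h.sq 2 (by omega)]
  have hcomm : ∀ i j, i + 1 < j → j < n →
      Commute (_root_.mergeFirst ρ i) (_root_.mergeFirst ρ j) := by
    intro i j hij hj
    obtain ⟨j, rfl⟩ := Nat.exists_eq_add_of_le' (show 2 ≤ j by omega)
    match i with
    | 0 => exact h.comm 1 (j + 3) (by omega) (by omega)
    | 1 =>
      exact (h.comm 0 (j + 3) (by omega) (by omega)).mul_left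
        (h.comm 2 (j + 3) (by omega) (by omega))
    | i + 2 => exact h.comm (i + 3) (j + 3) (by omega) (by omega)
  refine ⟨?_, ?_, hcomm, ?_, ?_, ?_⟩
  · intro i hi
    match i with
    | 0 => exact h.sq 1 (by omega)
    | 1 => exact hsq1
    | i + 2 => exact h.sq (i + 3) (by omega)
  · rw [eq_top_iff, ← h.gen]
    have h1 : 1 ∈ Set.Iio n := by simp only [Set.mem_Iio]; omega
    have h2 : 2 ∈ Set.Iio n := by simp only [Set.mem_Iio]; omega
    refine parabolic.le_of_forall fun k hk => ?_
    simp only [Set.mem_Iio] at hk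
    match k with
    | 0 => exact h.first_mem_mergeFirst hn h1 h2
    | 1 =>
      exact parabolic.mem (ρ := _root_.mergeFirst ρ) (k := 0)
        (by simp only [Set.mem_Iio]; omega)
    | 2 => exact h.third_mem_mergeFirst hn h1 h2
    | k + 3 =>
      exact parabolic.mem (ρ := _root_.mergeFirst ρ) (k := k + 2)
        (by simp only [Set.mem_Iio]; omega)
  · suffices h_inter : ∀ i j, i < j → j < n → parabolic (_root_.mergeFirst ρ) (Set.Ico i j) ⊓
        parabolic (_root_.mergeFirst ρ) (Set.Ico (i + 1) (j + 1))
        ≤ parabolic (_root_.mergeFirst ρ) (Set.Ico (i + 1) j) by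
      intro I J hI hJ
      refine parabolic.inf_le_of_intervals hcomm h_inter n 0 (by omega) I J ?_ ?_
      · exact fun k hk => ⟨Nat.zero_le _, by simpa using hI hk⟩
      · exact fun k hk => ⟨Nat.zero_le _, by simpa using hJ hk⟩
    intro i j hij hj g hg
    match i with
    | i + 1 =>
      have h1 : g ∈ parabolic ρ (Set.Ico (i + 3) (j + 1)) := by
        refine parabolic.mono ?_ (h.inter ({0} ∪ Set.Ico 2 (j + 1)) (Set.Ico (i + 3) (j + 2)) ?_ ?_
          ⟨mergeFirst_le ?_ ?_ ?_ hg.1, mergeFirst_le ?_ ?_ ?_ hg.2⟩) <;>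
          simp only [Set.subset_def, Set.mem_inter_iff, Set.mem_union, Set.mem_singleton_iff,
            Set.mem_Ico, Set.mem_Iio, true_and, true_or] <;>
          intros <;> omega
      refine parabolic.le_of_forall (fun k hk => ?_) h1
      obtain ⟨k, rfl⟩ := Nat.exists_eq_add_of_le' (show 3 ≤ k by have := hk.1; omega)
      refine parabolic.mem (ρ := _root_.mergeFirst ρ) (k := k + 2) ?_
      simp only [Set.mem_Ico] at hk ⊢
      omega
    | 0 =>
      obtain rfl | rfl | hj3 : j = 1 ∨ j = 2 ∨ 3 ≤ j := by omega
      · have h1 : g ∈ parabolic ρ ∅ := by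
          refine parabolic.mono ?_ (h.inter {1} {0, 2} ?_ ?_
            ⟨mergeFirst_le ?_ ?_ ?_ hg.1, mergeFirst_le ?_ ?_ ?_ hg.2⟩) <;>
            simp only [Set.subset_def, Set.mem_inter_iff, Set.mem_insert_iff, Set.mem_singleton_iff,
              Set.mem_empty_iff_false, Set.mem_Iio, Set.mem_Ico, true_or, or_true,
              and_true] <;>
            intros <;> first | trivial | omega
        rw [parabolic.empty, Subgroup.mem_bot] at h1
        rw [h1]
        exact one_mem _
      · have h1 : g ∈ parabolic ρ ({0} ∪ {2}) := by
          refine parabolic.mono ?_ (h.inter {0, 1, 2} {0, 2, 3} ?_ ?_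
            ⟨mergeFirst_le ?_ ?_ ?_ hg.1, mergeFirst_le ?_ ?_ ?_ hg.2⟩) <;>
            simp only [Set.subset_def, Set.mem_inter_iff, Set.mem_insert_iff, Set.mem_singleton_iff,
              Set.mem_union, Set.mem_Iio, Set.mem_Ico, true_or, or_true,
              and_true] <;>
            intros <;> first | trivial | omega
        have hD : parabolic (_root_.mergeFirst ρ) (Set.Ico 0 2) =
            Subgroup.closure {ρ 1, ρ 0 * ρ 2} := by
          have : Set.Ico 0 2 = ({0, 1} : Set ℕ) := by
            ext k
            simp
            omega
          rw [parabolic, this, Set.image_pair]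
          rfl
        have hg1 := hD ▸ hg.1
        have hmem : ρ 0 * ρ 2 ∈ parabolic (_root_.mergeFirst ρ) (Set.Ico (0 + 1) 2) :=
          parabolic.mem (ρ := _root_.mergeFirst ρ) (k := 1) (by simp)
        have hn1 := h.noncomm 0 (by omega)
        have hn2 := h.noncomm 1 (by omega)
        obtain ⟨y, hy, z, hz, rfl⟩ := parabolic.exists_mul_of_mem_union (by
          rintro _ rfl _ rfl
          exact hc02) h1
        have hs1 := h.sq 1 (by omega)
        rcases h.eq_one_or_eq_of_mem_singleton (by omega) hy with rfl | rfl <;>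
          rcases h.eq_one_or_eq_of_mem_singleton (by omega) hz with rfl | rfl
        · simp
        · rw [one_mul] at hg1
          rcases commute_or_commute_mul_of_mem_closure_pair hs1 hsq1 hg1
            (hc02.symm.mul_right (Commute.refl _)) with h2 | h2
          · exact absurd h2.symm hn2
          · rw [hc02.eq, ← mul_assoc, h.sq 2 (by omega), one_mul] at h2
            exact absurd h2 hn1
        · rw [mul_one] at hg1
          rcases commute_or_commute_mul_of_mem_closure_pair hs1 hsq1 hg1
            ((Commute.refl _).mul_right hc02) with h2 | h2
          · exact absurd h2 hn1
          · rw [← mul_assoc, h.sq 0 (by omega), one_mul] at h2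
            exact absurd h2.symm hn2
        · exact hmem
      · have h1 : g ∈ parabolic ρ ({0} ∪ Set.Ico 2 (j + 1)) := by
          refine parabolic.mono ?_ (h.inter (Set.Ico 0 (j + 1)) ({0} ∪ Set.Ico 2 (j + 2)) ?_ ?_
            ⟨mergeFirst_le ?_ ?_ ?_ hg.1, mergeFirst_le ?_ ?_ ?_ hg.2⟩) <;>
            simp only [Set.subset_def, Set.mem_inter_iff, Set.mem_union, Set.mem_singleton_iff, Set.mem_Ico,
              Set.mem_Iio, true_and, true_or] <;>
            intros <;> omega
        have hj1 : 1 ∈ Set.Ico (0 + 1) j := by simp only [Set.mem_Ico]; omega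
        have hj2 : 2 ∈ Set.Ico (0 + 1) j := by simp only [Set.mem_Ico]; omega
        refine parabolic.le_of_forall (fun k hk => ?_) h1
        simp only [Set.mem_union, Set.mem_singleton_iff, Set.mem_Ico] at hk
        match k with
        | 0 => exact h.first_mem_mergeFirst hn hj1 hj2
        | 1 => omega
        | 2 => exact h.third_mem_mergeFirst hn hj1 hj2
        | k + 3 =>
          refine parabolic.mem (ρ := _root_.mergeFirst ρ) (k := k + 2) ?_
          simp only [Set.mem_Ico]
          omega
  · intro i hi
    match i with
    | 0 =>
      intro hc
      have e : ρ 0 * ρ 1 * ρ 0 = ρ 2 * ρ 1 * ρ 2 := by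
        have h1 : ρ 1 * (ρ 0 * ρ 2) = ρ 0 * ρ 2 * ρ 1 := hc.eq
        calc ρ 0 * ρ 1 * ρ 0 = ρ 0 * (ρ 1 * (ρ 0 * ρ 2)) * ρ 2 := by
              simp only [mul_assoc, h.sq 2 (by omega), mul_one]
          _ = (ρ 0 * ρ 0) * ρ 2 * ρ 1 * ρ 2 := by rw [h1]; simp only [mul_assoc]
          _ = _ := by rw [h.sq 0 (by omega), one_mul]
      have h1 : ρ 0 * ρ 1 * ρ 0 ∈ parabolic ρ {1} := by
        refine parabolic.mono (S := {0, 1} ∩ {1, 2}) ?_ (h.inter _ _ ?_ ?_ ⟨?_, ?_⟩)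
        · rintro k ⟨rfl | rfl, hk⟩ <;> simp_all
        · rintro k (rfl | rfl) <;> simp only [Set.mem_Iio] <;> omega
        · rintro k (rfl | rfl) <;> simp only [Set.mem_Iio] <;> omega
        · exact mul_mem (mul_mem (parabolic.mem (by simp)) (parabolic.mem (by simp)))
            (parabolic.mem (by simp))
        · rw [e]
          exact mul_mem (mul_mem (parabolic.mem (by simp)) (parabolic.mem (by simp)))
            (parabolic.mem (by simp))
      apply h.noncomm 0 (by omega)
      rcases h.eq_one_or_eq_of_mem_singleton (by omega) h1 with h2 | h2
      · have : ρ 1 = 1 := by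
          rw [mul_eq_one_iff_eq_inv, h.inv_eq (by omega)] at h2
          simpa using h2
        rw [this]
        exact Commute.one_right _
      · rw [← eq_mul_inv_iff_mul_eq, h.inv_eq (by omega)] at h2
        exact h2
    | 1 =>
      intro hc
      apply h.noncomm 2 (by omega)
      have : ρ 2 = ρ 0 * (ρ 0 * ρ 2) := by rw [← mul_assoc, h.sq 0 (by omega), one_mul]
      rw [this]
      exact (h.comm 0 3 (by omega) (by omega)).mul_left hc
    | i + 2 => exact h.noncomm (i + 3) (by omega)
  · intro i hi hi'
    obtain ⟨i, rfl⟩ := Nat.exists_eq_add_of_le' hi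
    exact h.odd (i + 3) (by omega) (by omega)

end IsOddStringCGroup

/-- The action of a product of two transvections on the pair of coordinates that they change,
where `b` is the value of the form on the two transvection vectors. -/
def planeRotation {F : Type*} [Field F] (b : F) (p : F × F) : F × F :=
  (p.1 + b * (p.2 + b * p.1), p.2 + b * p.1)

/-- The quadratic form `x² + bxy + y²` is anisotropic, and `planeRotation b` is a rotation of odd
order acting transitively on its level sets. -/
structure IsFullRotation {F : Type*} [Field F] (b : F) : Prop where
  aniso : ∀ x y : F, x ^ 2 + b * x * y + y ^ 2 = 0 → x = 0 ∧ y = 0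
  trans : ∀ p p' : F × F, p.1 ^ 2 + b * p.1 * p.2 + p.2 ^ 2 =
    p'.1 ^ 2 + b * p'.1 * p'.2 + p'.2 ^ 2 → ∃ i : ℕ, (planeRotation b)^[i] p = p'
  odd : ∃ i : ℕ, ∀ p, (planeRotation b)^[2 * i + 1] p = p

theorem FiniteField.exists_algebraMap_eq_of_pow_card {F E : Type*} [Field F] [Fintype F]
    [Field E] [Algebra F E] {x : E} (hx : x ^ Fintype.card F = x) : ∃ y : F, algebraMap F E y = x := by
  have hlt : 1 < Fintype.card F := Fintype.one_lt_card
  have h : ((Finset.univ : Finset F).val.map fun a => Polynomial.X - Polynomial.C a).prod =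
      Polynomial.X ^ Fintype.card F - Polynomial.X := by
    rw [← FiniteField.roots_X_pow_card_sub_X F]
    refine Polynomial.prod_multiset_X_sub_C_of_monic_of_roots_card_eq ?_ ?_
    · exact Polynomial.monic_X_pow_sub (by simpa using hlt)
    · rw [FiniteField.roots_X_pow_card_sub_X, FiniteField.X_pow_card_sub_X_natDegree_eq F hlt]
      simp
  have h1 := congrArg (Polynomial.aeval x) h
  rw [map_sub, map_pow, Polynomial.aeval_X, hx, sub_self, ← Finset.prod_eq_multiset_prod,
    map_prod, Finset.prod_eq_zero_iff] at h1
  obtain ⟨a, -, ha⟩ := h1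
  refine ⟨a, ?_⟩
  rw [map_sub, Polynomial.aeval_X, Polynomial.aeval_C, sub_eq_zero] at ha
  exact ha.symm

namespace IsFullRotation

variable {F : Type*} [Field F] [Fintype F] [CharP F 2]

theorem of_isPrimitiveRoot {E : Type*} [Field E] [Algebra F E] {ζ : E}
    (hζ : IsPrimitiveRoot ζ (Fintype.card F + 1)) (hq : Even (Fintype.card F)) {b : F}
    (hb : algebraMap F E b = ζ + ζ⁻¹) : IsFullRotation b := by
  have hE : CharP E 2 := charP_of_injective_algebraMap (algebraMap F E).injective 2
  have h2 : (2 : E) = 0 := CharTwo.two_eq_zero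
  obtain ⟨r, hr⟩ := hq
  have hcard : 1 < Fintype.card F := Fintype.one_lt_card
  have hζ0 : ζ ≠ 0 := hζ.ne_zero (by omega)
  have hζq : ζ ^ Fintype.card F = ζ⁻¹ := by
    rw [← mul_left_inj' hζ0, ← pow_succ, hζ.pow_eq_one, inv_mul_cancel₀ hζ0]
  have hne : ζ + ζ⁻¹ ≠ 0 := by
    intro h
    have : ζ ^ 2 = 1 := by
      have : ζ = ζ⁻¹ := CharTwo.add_eq_zero.1 h
      rw [sq]; nth_rewrite 2 [this]; exact mul_inv_cancel₀ hζ0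
    have := Nat.le_of_dvd two_pos ((hζ.pow_eq_one_iff_dvd 2).1 this)
    omega
  let φ : F × F → E := fun p => algebraMap F E p.2 + algebraMap F E p.1 * ζ
  have hφq (p : F × F) : φ p ^ Fintype.card F = algebraMap F E p.2 + algebraMap F E p.1 * ζ⁻¹ := by
    have := map_add (FiniteField.frobeniusAlgHom F E) (algebraMap F E p.2)
      (algebraMap F E p.1 * ζ)
    simp only [map_mul, AlgHom.commutes, FiniteField.frobeniusAlgHom_apply, hζq] at this
    exact this
  have hφ0 (p : F × F) (h : φ p = 0) : p = 0 := by
    have h1 := hφq p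
    rw [h, zero_pow (by omega)] at h1
    have h3 : algebraMap F E p.1 * (ζ + ζ⁻¹) = 0 := by
      have : φ p = algebraMap F E p.2 + algebraMap F E p.1 * ζ := rfl
      rw [h] at this
      linear_combination -h1 - this - algebraMap F E p.2 * h2
    have h4 : p.1 = 0 := by simpa [hne] using h3
    have h5 : p.2 = 0 := by simpa [h4] using h1.symm
    exact Prod.ext h4 h5
  have hφi {p p' : F × F} (h : φ p = φ p') : p = p' := by
    rw [← sub_eq_zero]
    apply hφ0
    simp only [φ, Prod.fst_sub, Prod.snd_sub, map_sub] at h ⊢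
    linear_combination h
  have hφn (p : F × F) : φ p ^ (Fintype.card F + 1) =
      algebraMap F E (p.1 ^ 2 + b * p.1 * p.2 + p.2 ^ 2) := by
    rw [pow_succ, hφq]
    simp only [φ, map_add, map_mul, map_pow, hb]
    linear_combination (algebraMap F E p.1 ^ 2) * inv_mul_cancel₀ hζ0
  have hrot (p : F × F) : φ (planeRotation b p) = ζ ^ 2 * φ p := by
    simp only [φ, planeRotation, map_add, map_mul, hb]
    generalize algebraMap F E p.1 = x
    generalize algebraMap F E p.2 = y
    field_simp
    ring_nf
    linear_combination (y * ζ + x + 2 * ζ ^ 2 * x) * h2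
  have hiter (i : ℕ) (p : F × F) : φ ((planeRotation b)^[i] p) = ζ ^ (2 * i) * φ p := by
    induction i with
    | zero => simp
    | succ i ih => rw [Function.iterate_succ_apply', hrot, ih]; ring
  refine ⟨fun x y h => ?_, fun p p' h => ?_, ⟨r, fun p => hφi ?_⟩⟩
  · have := hφn (x, y)
    simp only [h, map_zero] at this
    simpa using hφ0 _ (pow_eq_zero_iff (by omega) |>.1 this)
  · have h1 : φ p ^ (Fintype.card F + 1) = φ p' ^ (Fintype.card F + 1) := by rw [hφn, hφn, h]
    by_cases h0 : φ p = 0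
    · refine ⟨0, ?_⟩
      rw [h0, zero_pow (by omega)] at h1
      have := (pow_eq_zero_iff (by omega)).1 h1.symm
      simp [hφ0 _ h0, hφ0 _ this]
    · have h3 : (φ p' / φ p) ^ (Fintype.card F + 1) = 1 := by
        rw [div_pow, ← h1, div_self (pow_ne_zero _ h0)]
      obtain ⟨i, -, hi⟩ := hζ.eq_pow_of_pow_eq_one h3
      refine ⟨i * (r + 1), hφi ?_⟩
      have : 2 * (i * (r + 1)) = (Fintype.card F + 1) * i + i := by rw [hr]; ring
      rw [hiter, this, pow_add, pow_mul, hζ.pow_eq_one, one_pow, one_mul, hi, div_mul_cancel₀ _ h0]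
  · have : 2 * (2 * r + 1) = (Fintype.card F + 1) * 2 := by rw [hr]; ring
    rw [hiter, this, pow_mul, hζ.pow_eq_one, one_pow, one_mul]

theorem exists_isFullRotation (hq : Even (Fintype.card F)) (h4 : 4 ≤ Fintype.card F) :
    ∃ b : F, b ≠ 0 ∧ b ≠ 1 ∧ IsFullRotation b ∧ IsFullRotation (b ^ 2) := by
  have hE : CharP (AlgebraicClosure F) 2 :=
    charP_of_injective_algebraMap (algebraMap F (AlgebraicClosure F)).injective 2
  have : NeZero ((Fintype.card F + 1 : ℕ) : AlgebraicClosure F) := by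
    refine ⟨?_⟩
    rw [Ne, CharP.cast_eq_zero_iff _ 2]
    obtain ⟨r, hr⟩ := hq
    omega
  obtain ⟨ζ, hζ⟩ := HasEnoughRootsOfUnity.exists_primitiveRoot (AlgebraicClosure F)
    (Fintype.card F + 1)
  have hζ0 : ζ ≠ 0 := hζ.ne_zero (by omega)
  have hζq : ζ ^ Fintype.card F = ζ⁻¹ := by
    rw [← mul_left_inj' hζ0, ← pow_succ, hζ.pow_eq_one, inv_mul_cancel₀ hζ0]
  obtain ⟨b, hb⟩ := FiniteField.exists_algebraMap_eq_of_pow_card (F := F) (x := ζ + ζ⁻¹) (by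
    have := map_add (FiniteField.frobeniusAlgHom F (AlgebraicClosure F)) ζ ζ⁻¹
    simp only [FiniteField.frobeniusAlgHom_apply, inv_pow, hζq, inv_inv] at this
    rw [this, add_comm])
  have hpow (n : ℕ) (hn : 0 < n) (hn' : n ≤ 3) : ζ ^ n ≠ 1 := by
    intro h
    have := Nat.le_of_dvd hn ((hζ.pow_eq_one_iff_dvd n).1 h)
    omega
  have h2 : (2 : AlgebraicClosure F) = 0 := CharTwo.two_eq_zero
  refine ⟨b, ?_, ?_, of_isPrimitiveRoot hζ hq hb, of_isPrimitiveRoot (ζ := ζ ^ 2) ?_ hq ?_⟩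
  · rintro rfl
    apply hpow 2 (by norm_num) (by norm_num)
    rw [map_zero] at hb
    have hi := mul_inv_cancel₀ hζ0
    linear_combination (-ζ) * hb - hi - h2
  · rintro rfl
    apply hpow 3 (by norm_num) (by norm_num)
    rw [map_one] at hb
    have hi := mul_inv_cancel₀ hζ0
    linear_combination (-(ζ + 1) * ζ) * hb - (ζ + 1) * hi - h2
  · refine hζ.pow_of_coprime 2 ?_
    rw [Nat.coprime_two_left]
    exact hq.add_one
  · rw [map_pow, hb, CharTwo.add_sq, inv_pow]

variable {b : F}

theorem card_lt (hF : IsFullRotation b) (hb : b ≠ 0) {x y : F} (hxy : ¬(x = 0 ∧ y = 0))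
    (A : Finset F) (hA : ∀ s t, s * x + t * y = s ^ 2 + t ^ 2 + b * s * t → t ∈ A) :
    Fintype.card F < 2 * A.card := by
  classical
  have h2 : (2 : F) = 0 := CharTwo.two_eq_zero
  have hsq (a : F) : ∃ r, r ^ 2 = a := by
    obtain ⟨r, hr⟩ := FiniteField.isSquare_of_char_two (ringChar.eq F 2) a
    exact ⟨r, by rw [hr, sq]⟩
  choose w hw using hsq
  set d : F := (x ^ 2 + b * x * y + y ^ 2) / b ^ 2 with hd
  have hd0 : d ≠ 0 := div_ne_zero (fun h => hxy (hF.aniso _ _ h)) (pow_ne_zero _ hb)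
  have hn0 (σ : F) : σ ^ 2 + b * σ + 1 ≠ 0 := fun h => by
    have := hF.aniso σ 1 (by linear_combination h)
    exact one_ne_zero this.2
  have hkey {S T : F} (h : S ^ 2 + b * S * T + T ^ 2 = d) : T + x / b ∈ A := by
    refine hA (S + y / b) (T + x / b) ?_
    obtain ⟨u, hu⟩ : ∃ u, x = b * u := ⟨x / b, by field_simp⟩
    obtain ⟨v, hv⟩ : ∃ v, y = b * v := ⟨y / b, by field_simp⟩
    rw [hd, eq_div_iff (pow_ne_zero _ hb), hu, hv] at h
    have h' : S ^ 2 + b * S * T + T ^ 2 = u ^ 2 + b * u * v + v ^ 2 := by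
      have : b ^ 2 ≠ 0 := pow_ne_zero _ hb
      rw [← mul_left_inj' this]
      linear_combination h
    rw [hu, hv, mul_div_cancel_left₀ _ hb, mul_div_cancel_left₀ _ hb]
    linear_combination -h' - (u ^ 2 + v ^ 2 + S * v + T * u) * h2
  let g : F → F := fun σ => w (d / (σ ^ 2 + b * σ + 1)) + x / b
  have hgA : Finset.univ.image g ⊂ A := by
    refine (Finset.ssubset_iff_of_subset ?_).2 ⟨x / b, ?_, ?_⟩
    · refine Finset.image_subset_iff.2 fun σ _ => ?_
      refine hkey (S := σ * w (d / (σ ^ 2 + b * σ + 1))) ?_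
      have := hw (d / (σ ^ 2 + b * σ + 1))
      rw [eq_div_iff (hn0 σ)] at this
      linear_combination this
    · have := hkey (S := w d) (T := 0) (by linear_combination hw d)
      simpa using this
    · intro h
      obtain ⟨σ, -, hσ⟩ := Finset.mem_image.1 h
      have h1 : w (d / (σ ^ 2 + b * σ + 1)) = 0 := by simpa [g] using hσ
      have := hw (d / (σ ^ 2 + b * σ + 1))
      rw [h1, zero_pow two_ne_zero] at this
      exact div_ne_zero hd0 (hn0 σ) this.symm
  have hle : Fintype.card F ≤ 2 * (Finset.univ.image g).card := by
    refine Finset.card_le_mul_card_image _ 2 fun c hc => ?_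
    obtain ⟨τ, -, rfl⟩ := Finset.mem_image.1 hc
    refine (Finset.card_le_card (t := {τ, τ + b}) ?_).trans Finset.card_le_two
    intro σ hσ
    have h1 : w (d / (σ ^ 2 + b * σ + 1)) = w (d / (τ ^ 2 + b * τ + 1)) := by
      simpa [g] using hσ
    have h3 : d / (σ ^ 2 + b * σ + 1) = d / (τ ^ 2 + b * τ + 1) := by
      rw [← hw (d / _), h1, hw]
    rw [div_eq_div_iff (hn0 _) (hn0 _)] at h3
    have h4 : (σ - τ) * (σ - (τ + b)) = 0 := by
      linear_combination -mul_left_cancel₀ hd0 h3 + (τ ^ 2 - σ * τ + b * τ - b * σ) * h2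
    rcases mul_eq_zero.1 h4 with h5 | h5
    · simp [sub_eq_zero.1 h5]
    · simp [sub_eq_zero.1 h5]
  have := Finset.card_lt_card hgA
  omega

theorem exists_shift_eq (hF : IsFullRotation b) (hb : b ≠ 0) {x y x' y' : F}
    (hxy : ¬(x = 0 ∧ y = 0)) (hxy' : ¬(x' = 0 ∧ y' = 0)) (c : F) :
    ∃ s t s' t', s * x + t * y = s ^ 2 + t ^ 2 + b * s * t ∧
      s' * x' + t' * y' = s' ^ 2 + t' ^ 2 + b * s' * t' ∧ t' = t + c := by
  classical
  let A : Finset F := {t | ∃ s, s * x + t * y = s ^ 2 + t ^ 2 + b * s * t}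
  let A' : Finset F := {t | ∃ s, s * x' + t * y' = s ^ 2 + t ^ 2 + b * s * t}
  have h1 := hF.card_lt hb hxy A fun s t h => by simpa [A] using ⟨s, h⟩
  have h2 := hF.card_lt hb hxy' A' fun s t h => by simpa [A'] using ⟨s, h⟩
  have h3 : ¬Disjoint (A.image (· + c)) A' := by
    intro h
    have h4 := Finset.card_union_of_disjoint h
    rw [Finset.card_image_of_injective _ (add_left_injective c)] at h4
    have := Finset.card_le_univ (A.image (· + c) ∪ A')
    omega
  rw [Finset.not_disjoint_iff] at h3
  obtain ⟨t', ht', ht''⟩ := h3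
  obtain ⟨t, ht, rfl⟩ := Finset.mem_image.1 ht'
  obtain ⟨s, hs⟩ := (Finset.mem_filter.1 ht).2
  obtain ⟨s', hs'⟩ := (Finset.mem_filter.1 ht'').2
  exact ⟨s, t, s', t + c, hs, hs', rfl⟩

theorem exists_step_of_ne (hb : b ≠ 0) {x y u z : F}
    (h : z * (x + u) * b ^ 2 ≠ x ^ 2 + b * x * y + y ^ 2) :
    ∃ s t, s * x + t * y + z * u = s ^ 2 + t ^ 2 + z ^ 2 + b * s * t + b * t * z ∧
      y + b * s + b * z ≠ 0 := by
  have h2 : (2 : F) = 0 := CharTwo.two_eq_zero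
  obtain ⟨t, rfl⟩ : ∃ t, x = b * t := ⟨x / b, by field_simp⟩
  obtain ⟨v, rfl⟩ : ∃ v, y = b * v := ⟨y / b, by field_simp⟩
  obtain ⟨r, hr⟩ := FiniteField.isSquare_of_char_two (ringChar.eq F 2)
    (t ^ 2 + b * t * v + v ^ 2 + z * (b * t + u))
  have hr0 : r ≠ 0 := by
    rintro rfl
    apply h
    linear_combination b ^ 2 * hr - b ^ 2 * (t ^ 2 + b * t * v + v ^ 2) * h2
  refine ⟨r + z + v, t, ?_, ?_⟩
  · linear_combination hr -
      (r * z + r * v + z * v + z * b * t + z ^ 2 + v ^ 2 + t ^ 2) * h2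
  · have : b * v + b * (r + z + v) + b * z = b * r := by linear_combination b * (v + z) * h2
    rw [this]
    exact mul_ne_zero hb hr0

theorem exists_step_step (hF : IsFullRotation b) (hb : b ≠ 0) (h4 : 4 ≤ Fintype.card F)
    {x y u x' y' u' : F} (hxy : ¬(x = 0 ∧ y = 0)) (hxy' : ¬(x' = 0 ∧ y' = 0)) (c : F) :
    ∃ s t z s' t' z', s * x + t * y + z * u = s ^ 2 + t ^ 2 + z ^ 2 + b * s * t + b * t * z ∧
      s' * x' + t' * y' + z' * u' = s' ^ 2 + t' ^ 2 + z' ^ 2 + b * s' * t' + b * t' * z' ∧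
      y + b * s + b * z ≠ 0 ∧ y' + b * s' + b * z' ≠ 0 ∧ z' = z + c := by
  classical
  have key {x y u : F} (hxy : ¬(x = 0 ∧ y = 0)) :
      ∃ e, ∀ z, z ≠ e → z * (x + u) * b ^ 2 ≠ x ^ 2 + b * x * y + y ^ 2 := by
    by_cases hu : x + u = 0
    · refine ⟨0, fun z _ h => hxy (hF.aniso x y ?_)⟩
      rw [← h, hu]; ring
    · refine ⟨(x ^ 2 + b * x * y + y ^ 2) / ((x + u) * b ^ 2), fun z hz h => hz ?_⟩
      rw [eq_div_iff (mul_ne_zero hu (pow_ne_zero _ hb)), ← h]; ring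
  obtain ⟨e, he⟩ := key (u := u) hxy
  obtain ⟨e', he'⟩ := key (u := u') hxy'
  obtain ⟨z, hz⟩ : ∃ z, z ∉ ({e, e' - c} : Finset F) := by
    by_contra! h
    have h1 := Finset.card_le_card (fun z _ => h z : (Finset.univ : Finset F) ⊆ {e, e' - c})
    have h2 : ({e, e' - c} : Finset F).card ≤ 2 := Finset.card_le_two
    rw [Finset.card_univ] at h1
    omega
  simp only [Finset.mem_insert, Finset.mem_singleton, not_or] at hz
  obtain ⟨s, t, h1, h2⟩ := exists_step_of_ne hb (he z hz.1)
  obtain ⟨s', t', h1', h2'⟩ := exists_step_of_ne hb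
    (he' (z + c) fun h => hz.2 (by rw [← h, add_sub_cancel_right]))
  exact ⟨s, t, z, s', t', z + c, h1, h1', h2, h2', rfl⟩

end IsFullRotation

/-- A group acting faithfully on a space with a nondegenerate alternating form, and containing all
the symplectic transvections. -/
structure IsTransvectionFamily {F M G : Type*} [Field F] [AddCommGroup M] [Module F M] [Group G]
    (B : LinearMap.BilinForm F M) (act : G →* Module.End F M) (T : M → G) : Prop where
  inj : Function.Injective act
  alt : ∀ x, B x x = 0
  nondeg : ∀ x, (∀ y, B x y = 0) → x = 0
  preserves : ∀ g x y, B (act g x) (act g y) = B x y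
  apply : ∀ v x, act (T v) x = x + B x v • v

namespace IsTransvectionFamily

variable {F M G : Type*} [Field F] [AddCommGroup M] [Module F M] [Group G]
  {B : LinearMap.BilinForm F M} {act : G →* Module.End F M} {T : M → G}

theorem act_inv_act (g : G) (x : M) : act g⁻¹ (act g x) = x := by
  rw [← Module.End.mul_apply, ← map_mul, inv_mul_cancel, map_one, Module.End.one_apply]

theorem act_act_inv (g : G) (x : M) : act g (act g⁻¹ x) = x := by
  rw [← Module.End.mul_apply, ← map_mul, mul_inv_cancel, map_one, Module.End.one_apply]

theorem act_mul (g h : G) (x : M) : act (g * h) x = act g (act h x) := by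
  rw [map_mul, Module.End.mul_apply]

theorem ext_act (h : IsTransvectionFamily B act T) {g g' : G} (hg : ∀ x, act g x = act g' x) :
    g = g' :=
  h.inj (LinearMap.ext hg)

theorem conj (h : IsTransvectionFamily B act T) (g : G) (v : M) :
    g * T v * g⁻¹ = T (act g v) := by
  refine h.ext_act fun x => ?_
  rw [act_mul, act_mul, h.apply, h.apply, map_add, map_smul, act_act_inv,
    ← h.preserves g (act g⁻¹ x), act_act_inv]

variable [CharP F 2]

theorem add_self (F : Type*) [Field F] [CharP F 2] [Module F M] (x : M) : x + x = 0 := by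
  rw [← two_smul F x, CharTwo.two_eq_zero, zero_smul]

theorem symm (h : IsTransvectionFamily B act T) (x y : M) : B x y = B y x := by
  have h1 := h.alt (x + y)
  simp only [map_add, LinearMap.add_apply, h.alt, zero_add, add_zero] at h1
  exact (CharTwo.add_eq_zero.1 h1).symm

theorem mul_self (h : IsTransvectionFamily B act T) (v : M) : T v * T v = 1 := by
  refine h.ext_act fun x => ?_
  rw [act_mul, h.apply, h.apply, map_one, Module.End.one_apply, map_add, map_smul,
    LinearMap.add_apply, LinearMap.smul_apply, h.alt, smul_zero, add_zero, add_assoc, add_self F,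
    add_zero]

theorem commute (h : IsTransvectionFamily B act T) {u v : M} (huv : B u v = 0) :
    Commute (T u) (T v) := by
  refine h.ext_act fun x => ?_
  simp only [act_mul, h.apply, map_add, map_smul, LinearMap.add_apply, LinearMap.smul_apply, huv,
    h.symm v u, smul_zero, add_zero]
  abel

theorem not_commute (h : IsTransvectionFamily B act T) {u v : M} (huv : B u v ≠ 0) :
    ¬Commute (T u) (T v) := by
  intro hc
  have h1 : act (T u * T v) u = act (T v * T u) u := by rw [hc.eq]
  simp only [act_mul, h.apply, map_add, map_smul, LinearMap.add_apply, LinearMap.smul_apply, h.alt,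
    h.symm v u, zero_smul, add_zero, smul_eq_mul] at h1
  rw [zero_add, add_eq_left, smul_eq_zero, mul_self_eq_zero] at h1
  rcases h1 with h1 | rfl
  · exact huv h1
  · simp at huv

/-- A subgroup that contains all the transvections is the whole group. -/
theorem eq_top [Finite F] [FiniteDimensional F M] (h : IsTransvectionFamily B act T)
    {H : Subgroup G} (hH : ∀ v, T v ∈ H) : H = ⊤ := by
  have hsq (a : F) : ∃ r, r * r = a := by
    obtain ⟨r, hr⟩ := FiniteField.isSquare_of_char_two (ringChar.eq F 2) a
    exact ⟨r, hr.symm⟩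
  have move (x y : M) (hxy : B x y ≠ 0) : ∃ t ∈ H, act t y = x ∧
      ∀ z, B z x = B z y → act t z = z := by
    obtain ⟨r, hr⟩ := hsq (B x y)⁻¹
    refine ⟨T (r • (x - y)), hH _, ?_, fun z hz => ?_⟩
    · rw [h.apply, map_smul, map_sub, h.alt, sub_zero, h.symm y x, smul_smul, smul_eq_mul,
        mul_assoc, mul_comm (B x y), ← mul_assoc, hr, inv_mul_cancel₀ hxy, one_smul]
      abel
    · rw [h.apply, map_smul, map_sub, hz, sub_self, smul_zero, zero_smul, add_zero]
  have key (U : Submodule F M) : ∀ g, LinearMap.ker (act g - 1) = U → g ∈ H := by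
    induction U using WellFoundedGT.induction with
    | ind U ih =>
      intro g hg
      have hfix {z : M} : z ∈ U ↔ act g z = z := by
        rw [← hg, LinearMap.mem_ker, LinearMap.sub_apply, Module.End.one_apply, sub_eq_zero]
      have hB {z v : M} (hz : z ∈ U) : B z (act g v) = B z v := by
        conv_lhs => rw [← hfix.1 hz]
        exact h.preserves _ _ _
      have done {t : G} {v : M} (ht : t ∈ H) (h1 : act t (act g v) = v) (hv : v ∉ U)
          (h2 : ∀ z ∈ U, act t z = z) : g ∈ H := by
        rw [← H.mul_mem_cancel_left ht]
        refine ih _ ?_ _ rfl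
        refine lt_of_le_of_ne (fun z hz => ?_) fun h3 => hv ?_
        · rw [LinearMap.mem_ker, LinearMap.sub_apply, Module.End.one_apply, act_mul, hfix.1 hz,
            h2 z hz, sub_self]
        · rw [h3, LinearMap.mem_ker, LinearMap.sub_apply, Module.End.one_apply, act_mul, h1,
            sub_self]
      by_cases hv : ∃ v, B v (act g v) ≠ 0
      · obtain ⟨v, hv⟩ := hv
        obtain ⟨t, ht, h1, h2⟩ := move v (act g v) hv
        refine done ht h1 (fun hU => hv ?_) fun z hz => h2 z (hB hz).symm
        rw [hfix.1 hU, h.alt]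
      · push Not at hv
        by_cases hU : U = ⊤
        · have : g = 1 := h.ext_act fun x => by
            rw [hfix.1 (hU ▸ Submodule.mem_top), map_one, Module.End.one_apply]
          exact this ▸ one_mem H
        · obtain ⟨v, -, hvU⟩ := SetLike.exists_of_lt (lt_top_iff_ne_top.2 hU)
          have hne : act g v - v ≠ 0 := fun h0 => hvU (hfix.2 (sub_eq_zero.1 h0))
          obtain ⟨z, hz⟩ : ∃ z, B (act g v - v) z ≠ 0 := by
            by_contra! h0
            exact hne (h.nondeg _ h0)
          have h2 : (2 : F) = 0 := CharTwo.two_eq_zero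
          have hp := hv (v + z)
          simp only [map_add, LinearMap.add_apply, hv, zero_add, add_zero] at hp
          simp only [map_sub, LinearMap.sub_apply] at hz
          obtain ⟨t, ht, ht1, ht2⟩ := move (v + (act g z - z)) (act g v) (by
            simp only [map_add, map_sub, LinearMap.add_apply, LinearMap.sub_apply, hv,
              h.preserves]
            intro h0
            apply hz
            linear_combination h.symm (act g v) z - h.symm v z - h0)
          obtain ⟨s, hs, hs1, hs2⟩ := move v (v + (act g z - z)) (by
            simp only [map_add, map_sub, h.alt]
            intro h0
            apply hz
            linear_combination h0 - hp + B z (act g v) * h2 + h.symm (act g v) z)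
          refine done (H.mul_mem hs ht) (by rw [act_mul, ht1, hs1]) hvU fun u hu => ?_
          rw [act_mul, ht2, hs2] <;> simp [hB hu]
  exact (Subgroup.eq_top_iff' H).2 fun g => key _ g rfl

end IsTransvectionFamily

section

open Set

set_option linter.unusedSectionVars false

/-- The values of the form on consecutive vectors of a transvection chain. -/
def chainWeight {F : Type*} [Field F] (b : F) (k : ℕ) : F :=
  if k = 0 then b ^ 2 else b

/-- A chain of vectors `f 0, …, f (2 * m)` whose transvections will be shown to form a string
C-group representation; `q₀` is a quadratic form polarizing to `B` that vanishes on the chain. -/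
structure IsTransvectionChain {F M G : Type*} [Field F] [Fintype F] [AddCommGroup M] [Module F M]
    [Group G] (B : LinearMap.BilinForm F M) (act : G →* Module.End F M) (T : M → G) (m : ℕ) (b : F)
    (f : ℕ → M) (q₀ : M → F) : Prop extends IsTransvectionFamily B act T where
  b_ne_zero : b ≠ 0
  b_ne_one : b ≠ 1
  full : IsFullRotation b
  full_sq : IsFullRotation (b ^ 2)
  four_le : 4 ≤ Fintype.card F
  quad_add : ∀ x y, q₀ (x + y) = q₀ x + q₀ y + B x y
  quad_smul : ∀ (c : F) x, q₀ (c • x) = c ^ 2 * q₀ x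
  quad_chain : ∀ k ≤ 2 * m, q₀ (f k) = 0
  weight : ∀ k, k + 1 ≤ 2 * m → B (f k) (f (k + 1)) = chainWeight b k
  orth : ∀ k l, k + 1 < l → l ≤ 2 * m → B (f k) (f l) = 0
  span : ∀ x, ∃ a ∈ Finsupp.supported F F (Iio (2 * m + 1)), Finsupp.linearCombination F f a = x
  rel : f 0 + b • ∑ i ∈ Finset.range m, f (2 * i + 2) = 0

namespace IsTransvectionChain

variable {F M G : Type*} [Field F] [Fintype F] [CharP F 2] [AddCommGroup M] [Module F M]
  [Group G] {B : LinearMap.BilinForm F M} {act : G →* Module.End F M} {T : M → G} {m : ℕ} {b : F}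
  {f : ℕ → M} {q₀ : M → F}

/-- The quadratic form on coordinates with value `1` on each basis vector of the chain. -/
noncomputable def quad (q₀ : M → F) (f : ℕ → M) (a : ℕ →₀ F) : F :=
  Finsupp.linearCombination F (fun _ => (1 : F)) a ^ 2 + q₀ (Finsupp.linearCombination F f a)

/-- The vector `y` differs from `x` by the combination `a` of the chain, in a way that is compatible
with a product of the transvections of the chain carrying `x` to `y`. -/
def StepBy (B : LinearMap.BilinForm F M) (q₀ : M → F) (f : ℕ → M) (a : ℕ →₀ F) (x y : M) : Prop :=
  y = x + Finsupp.linearCombination F f a ∧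
    B x (Finsupp.linearCombination F f a) = quad q₀ f a

/-- A transvection-compatible difference using only the members of the chain with index in `I`. -/
def Step (B : LinearMap.BilinForm F M) (q₀ : M → F) (f : ℕ → M) (I : Set ℕ) (x y : M) : Prop :=
  ∃ a ∈ Finsupp.supported F F I, StepBy B q₀ f a x y

/-- Lying in the same orbit of the subgroup generated by the transvections with index in `I`. -/
def Reach (act : G →* Module.End F M) (T : M → G) (f : ℕ → M) (I : Set ℕ) (x y : M) : Prop :=
  ∃ g ∈ parabolic (fun k => T (f k)) I, act g x = y

/-- The vector `x` is not orthogonal to all the members of the chain with index in `I`. -/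
def Good (B : LinearMap.BilinForm F M) (f : ℕ → M) (I : Set ℕ) (x : M) : Prop :=
  ∃ k ∈ I, B x (f k) ≠ 0

/-- On vectors that are not fixed, a transvection-compatible difference is realized by the group. -/
def Realizes (B : LinearMap.BilinForm F M) (act : G →* Module.End F M) (T : M → G) (f : ℕ → M)
    (q₀ : M → F) (I : Set ℕ) : Prop :=
  ∀ x y, Step B q₀ f I x y → Good B f I x → Good B f I y → Reach act T f I x y

omit [Fintype F] [CharP F 2] in
theorem Reach.refl (I : Set ℕ) (x : M) : Reach act T f I x x :=
  ⟨1, one_mem _, by simp⟩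

omit [Fintype F] [CharP F 2] in
theorem Reach.trans {I : Set ℕ} {x y z : M} (h : Reach act T f I x y) (h' : Reach act T f I y z) :
    Reach act T f I x z := by
  obtain ⟨g, hg, rfl⟩ := h
  obtain ⟨g', hg', rfl⟩ := h'
  exact ⟨g' * g, mul_mem hg' hg, IsTransvectionFamily.act_mul _ _ _⟩

omit [Fintype F] [CharP F 2] in
theorem Reach.symm {I : Set ℕ} {x y : M} (h : Reach act T f I x y) : Reach act T f I y x := by
  obtain ⟨g, hg, rfl⟩ := h
  exact ⟨g⁻¹, inv_mem hg, IsTransvectionFamily.act_inv_act _ _⟩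

omit [Fintype F] [CharP F 2] in
theorem Reach.mono {I J : Set ℕ} (hIJ : I ⊆ J) {x y : M} (h : Reach act T f I x y) :
    Reach act T f J x y := by
  obtain ⟨g, hg, rfl⟩ := h
  exact ⟨g, parabolic.mono hIJ hg, rfl⟩

omit [Fintype F] [CharP F 2] in
theorem mem_supported_of_eq_zero {I J : Set ℕ} {a : ℕ →₀ F} (ha : a ∈ Finsupp.supported F F I)
    (hIJ : ∀ k ∈ I, k ∈ J ∨ a k = 0) : a ∈ Finsupp.supported F F J := by
  rw [Finsupp.mem_supported] at ha ⊢
  intro k hk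
  exact (hIJ k (ha hk)).resolve_right (Finsupp.mem_support_iff.1 hk)

theorem chainWeight_succ (b : F) (k : ℕ) : chainWeight b (k + 1) = b := by
  simp [chainWeight]

/-- The coordinates supported on three consecutive members of the chain. -/
noncomputable def triple (j : ℕ) (s t z : F) : ℕ →₀ F :=
  Finsupp.single j s + Finsupp.single (j + 1) t + Finsupp.single (j + 2) z

theorem triple_mem (j : ℕ) (s t z : F) : triple j s t z ∈ Finsupp.supported F F (Ico j (j + 3)) :=
  add_mem (add_mem (Finsupp.single_mem_supported F _ (by simp))
    (Finsupp.single_mem_supported F _ (by simp))) (Finsupp.single_mem_supported F _ (by simp))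

theorem triple_apply_last (j : ℕ) (s t z : F) : triple j s t z (j + 2) = z := by
  simp [triple]

/-- If adding up three compatible differences cancels the last coordinate, that coordinate is not
needed. -/
theorem mem_supported_Ico_of_cancel {i j : ℕ} (hij : i ≤ j) {s t z s' t' z' : F} {a : ℕ →₀ F}
    (ha : a ∈ Finsupp.supported F F (Ico i (j + 3))) (hz : z + a (j + 2) + z' = 0) :
    triple j s t z + a + triple j s' t' z' ∈ Finsupp.supported F F (Ico i (j + 2)) := by
  have hsub : Ico j (j + 3) ⊆ Ico i (j + 3) := Ico_subset_Ico_left hij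
  refine mem_supported_of_eq_zero (add_mem (add_mem (Finsupp.supported_mono hsub
    (triple_mem _ _ _ _)) ha) (Finsupp.supported_mono hsub (triple_mem _ _ _ _))) fun k hk => ?_
  by_cases hkj : k = j + 2
  · subst hkj
    right
    simp only [Finsupp.add_apply, triple_apply_last, hz]
  · left
    simp at hk ⊢
    omega

theorem pairing_eq_zero {I : Set ℕ} {a : ℕ →₀ F} (ha : a ∈ Finsupp.supported F F I) {y : M}
    (hy : ∀ k ∈ I, B y (f k) = 0) : B y (Finsupp.linearCombination F f a) = 0 := by
  rw [Finsupp.linearCombination_apply, Finsupp.sum, map_sum]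
  refine Finset.sum_eq_zero fun k hk => ?_
  rw [map_smul, hy k (ha hk), smul_zero]

theorem sum_range_two_mul_add_one (g : ℕ → F) (m : ℕ) : ∑ k ∈ Finset.range (2 * m + 1), g k =
    g 0 + ∑ i ∈ Finset.range m, (g (2 * i + 1) + g (2 * i + 2)) := by
  induction m with
  | zero => simp
  | succ m ih =>
    rw [Finset.sum_range_succ _ m, ← add_assoc, ← ih, mul_add, Finset.sum_range_succ,
      Finset.sum_range_succ, add_assoc]

variable (h : IsTransvectionChain B act T m b f q₀)
include h

theorem weight_ne_zero (k : ℕ) : chainWeight b k ≠ 0 := by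
  unfold chainWeight
  split_ifs
  · exact pow_ne_zero _ h.b_ne_zero
  · exact h.b_ne_zero

theorem full_weight (k : ℕ) : IsFullRotation (chainWeight b k) := by
  unfold chainWeight
  split_ifs
  · exact h.full_sq
  · exact h.full

theorem weight_symm {k : ℕ} (hk : k + 1 ≤ 2 * m) : B (f (k + 1)) (f k) = chainWeight b k := by
  rw [h.symm, h.weight k hk]

theorem orth_symm {k l : ℕ} (hk : k + 1 < l) (hl : l ≤ 2 * m) : B (f l) (f k) = 0 := by
  rw [h.symm, h.orth k l hk hl]

theorem quad_coord_add (a c : ℕ →₀ F) : quad q₀ f (a + c) = quad q₀ f a + quad q₀ f c +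
    B (Finsupp.linearCombination F f a) (Finsupp.linearCombination F f c) := by
  unfold quad
  rw [map_add, map_add, h.quad_add, CharTwo.add_sq]
  ring

theorem quad_single {k : ℕ} (hk : k ≤ 2 * m) (t : F) : quad q₀ f (Finsupp.single k t) = t ^ 2 := by
  simp [quad, h.quad_smul, h.quad_chain k hk]

theorem stepBy_zero (x : M) : StepBy B q₀ f 0 x x := by
  have : q₀ 0 = 0 := by simpa using h.quad_smul 0 0
  simp [StepBy, quad, this]

theorem stepBy_trans {a c : ℕ →₀ F} {x y z : M} (h1 : StepBy B q₀ f a x y)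
    (h2 : StepBy B q₀ f c y z) : StepBy B q₀ f (a + c) x z := by
  obtain ⟨rfl, h1⟩ := h1
  obtain ⟨rfl, h2⟩ := h2
  refine ⟨by rw [map_add, add_assoc], ?_⟩
  rw [map_add, LinearMap.add_apply] at h2
  rw [h.quad_coord_add, map_add, map_add, ← h1, ← h2]
  linear_combination -B (Finsupp.linearCombination F f a) (Finsupp.linearCombination F f c) *
    (CharTwo.two_eq_zero : (2 : F) = 0)

theorem stepBy_symm {a : ℕ →₀ F} {x y : M} (h1 : StepBy B q₀ f a x y) : StepBy B q₀ f a y x := by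
  obtain ⟨rfl, h1⟩ := h1
  refine ⟨?_, ?_⟩
  · rw [add_assoc, IsTransvectionFamily.add_self F, add_zero]
  · rw [map_add, LinearMap.add_apply, h.alt, add_zero, h1]

theorem stepBy_transvection {k : ℕ} (hk : k ≤ 2 * m) (x : M) :
    StepBy B q₀ f (Finsupp.single k (B x (f k))) x (act (T (f k)) x) := by
  refine ⟨by rw [h.apply, Finsupp.linearCombination_single], ?_⟩
  rw [h.quad_single hk, Finsupp.linearCombination_single, map_smul, smul_eq_mul, sq]

omit h in
theorem Step.mono {I J : Set ℕ} (hIJ : I ⊆ J) {x y : M} (h : Step B q₀ f I x y) :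
    Step B q₀ f J x y := by
  obtain ⟨a, ha, h⟩ := h
  exact ⟨a, Finsupp.supported_mono hIJ ha, h⟩

theorem step_trans {I : Set ℕ} {x y z : M} (h1 : Step B q₀ f I x y) (h2 : Step B q₀ f I y z) :
    Step B q₀ f I x z := by
  obtain ⟨a, ha, h1⟩ := h1
  obtain ⟨c, hc, h2⟩ := h2
  exact ⟨a + c, add_mem ha hc, h.stepBy_trans h1 h2⟩

theorem step_symm {I : Set ℕ} {x y : M} (h1 : Step B q₀ f I x y) : Step B q₀ f I y x := by
  obtain ⟨a, ha, h1⟩ := h1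
  exact ⟨a, ha, h.stepBy_symm h1⟩

theorem step_of_mem {I : Set ℕ} (hI : I ⊆ Iio (2 * m + 1)) {g : G}
    (hg : g ∈ parabolic (fun k => T (f k)) I) : ∀ x, Step B q₀ f I x (act g x) := by
  unfold parabolic at hg
  induction hg using Subgroup.closure_induction with
  | mem g hg =>
    obtain ⟨k, hk, rfl⟩ := hg
    exact fun x => ⟨_, Finsupp.single_mem_supported F _ hk,
      h.stepBy_transvection (Nat.lt_succ_iff.1 (hI hk)) x⟩
  | one => exact fun x => ⟨0, zero_mem _, by simpa using h.stepBy_zero x⟩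
  | mul g g' _ _ h1 h2 =>
    intro x
    rw [IsTransvectionFamily.act_mul]
    exact h.step_trans (h2 x) (h1 _)
  | inv g _ h1 =>
    intro x
    have := h.step_symm (h1 (act g⁻¹ x))
    rwa [IsTransvectionFamily.act_act_inv] at this

theorem step_of_reach {I : Set ℕ} (hI : I ⊆ Iio (2 * m + 1)) {x y : M} (h1 : Reach act T f I x y) :
    Step B q₀ f I x y := by
  obtain ⟨g, hg, rfl⟩ := h1
  exact h.step_of_mem hI hg x

omit h in
theorem reach_transvection {I : Set ℕ} {k : ℕ} (hk : k ∈ I) (x : M) :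
    Reach act T f I x (act (T (f k)) x) :=
  ⟨_, parabolic.mem hk, rfl⟩

/-- It suffices to realize differences up to moving the two vectors. -/
theorem reach_of_reach {I : Set ℕ} (hI : I ⊆ Iio (2 * m + 1)) {x y x' y' : M}
    (hx : Reach act T f I x x') (hy : Reach act T f I y y') (hxy : Step B q₀ f I x y)
    (h1 : Step B q₀ f I x' y' → Reach act T f I x' y') : Reach act T f I x y :=
  (hx.trans (h1 (h.step_trans (h.step_symm (h.step_of_reach hI hx))
    (h.step_trans hxy (h.step_of_reach hI hy))))).trans hy.symm

theorem rotation_pairing {j : ℕ} (hj : j + 1 ≤ 2 * m) (i : ℕ) (x : M) :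
    (B (act ((T (f (j + 1)) * T (f j)) ^ i) x) (f j),
      B (act ((T (f (j + 1)) * T (f j)) ^ i) x) (f (j + 1))) =
    (planeRotation (chainWeight b j))^[i] (B x (f j), B x (f (j + 1))) := by
  induction i with
  | zero => simp
  | succ i ih =>
    rw [Function.iterate_succ_apply', ← ih, pow_succ', IsTransvectionFamily.act_mul]
    generalize act ((T (f (j + 1)) * T (f j)) ^ i) x = y
    simp only [IsTransvectionFamily.act_mul, h.apply, map_add, map_smul, LinearMap.add_apply,
      LinearMap.smul_apply, h.alt, h.weight j hj, h.weight_symm hj, planeRotation, smul_eq_mul]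
    ext <;> ring

theorem rotation_mem {j : ℕ} (i : ℕ) :
    (T (f (j + 1)) * T (f j)) ^ i ∈ parabolic (fun k => T (f k)) (Ico j (j + 2)) :=
  pow_mem (mul_mem (parabolic.mem (ρ := fun k => T (f k)) (by simp))
    (parabolic.mem (ρ := fun k => T (f k)) (by simp))) i

omit h in
theorem exists_eq_of_mem_supported_pair {j : ℕ} {a : ℕ →₀ F}
    (ha : a ∈ Finsupp.supported F F (Ico j (j + 2))) :
    a = Finsupp.single j (a j) + Finsupp.single (j + 1) (a (j + 1)) := by
  ext k
  rw [Finsupp.add_apply, Finsupp.single_apply, Finsupp.single_apply]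
  by_cases hk : k ∈ Ico j (j + 2)
  · have : k = j ∨ k = j + 1 := by simp at hk; omega
    rcases this with rfl | rfl <;> simp
  · have h0 : a k = 0 := by
      by_contra h0
      exact hk (ha (Finsupp.mem_support_iff.2 h0))
    simp only [mem_Ico] at hk
    rw [if_neg (by omega), if_neg (by omega), h0, add_zero]

theorem quad_pair {j : ℕ} (hj : j + 1 ≤ 2 * m) (s t : F) :
    quad q₀ f (Finsupp.single j s + Finsupp.single (j + 1) t) =
      s ^ 2 + t ^ 2 + chainWeight b j * s * t := by
  rw [h.quad_coord_add, h.quad_single (by omega), h.quad_single (by omega)]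
  simp only [Finsupp.linearCombination_single, map_smul, LinearMap.smul_apply, h.weight j hj,
    smul_eq_mul]
  ring

theorem eq_zero_of_pairing_pair {j : ℕ} (hj : j + 1 ≤ 2 * m) {s t : F}
    (h1 : B (s • f j + t • f (j + 1)) (f j) = 0)
    (h2 : B (s • f j + t • f (j + 1)) (f (j + 1)) = 0) : s = 0 ∧ t = 0 := by
  have hw := h.weight_ne_zero j
  simp only [map_add, map_smul, LinearMap.add_apply, LinearMap.smul_apply, h.alt, h.weight j hj,
    h.weight_symm hj, smul_eq_mul] at h1 h2
  constructor
  · simpa [hw] using h2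
  · simpa [hw] using h1

theorem eq_of_step_pair {j : ℕ} (hj : j + 1 ≤ 2 * m) {x y : M}
    (hxy : Step B q₀ f (Ico j (j + 2)) x y) (h1 : B x (f j) = B y (f j))
    (h2 : B x (f (j + 1)) = B y (f (j + 1))) : x = y := by
  obtain ⟨a, ha, rfl, -⟩ := hxy
  rw [exists_eq_of_mem_supported_pair ha] at h1 h2 ⊢
  rw [map_add (Finsupp.linearCombination F f), Finsupp.linearCombination_single,
    Finsupp.linearCombination_single] at h1 h2 ⊢
  rw [map_add, LinearMap.add_apply, left_eq_add] at h1 h2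
  obtain ⟨h3, h4⟩ := h.eq_zero_of_pairing_pair hj h1 h2
  rw [h3, h4, zero_smul, zero_smul, add_zero, add_zero]

theorem reach_pair {j : ℕ} (hj : j + 1 ≤ 2 * m) {x y : M}
    (hxy : Step B q₀ f (Ico j (j + 2)) x y) : Reach act T f (Ico j (j + 2)) x y := by
  have hsub : Ico j (j + 2) ⊆ Iio (2 * m + 1) := fun k hk => by simp at hk ⊢; omega
  obtain ⟨i, hi⟩ := (h.full_weight j).trans (B x (f j), B x (f (j + 1)))
    (B y (f j), B y (f (j + 1))) (by
      obtain ⟨a, ha, rfl, h1⟩ := hxy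
      rw [exists_eq_of_mem_supported_pair ha] at h1 ⊢
      rw [h.quad_pair hj] at h1
      simp only [map_add, map_smul, LinearMap.add_apply, LinearMap.smul_apply, h.alt,
        h.weight j hj, h.weight_symm hj, smul_eq_mul, Finsupp.linearCombination_single] at h1 ⊢
      linear_combination (-chainWeight b j ^ 2) * h1 -
        (B x (f j) * chainWeight b j * a (j + 1) + chainWeight b j * B x (f (j + 1)) * a j +
          chainWeight b j ^ 2 * a j ^ 2 + chainWeight b j ^ 2 * a (j + 1) ^ 2 +
          chainWeight b j ^ 3 * a j * a (j + 1)) * (CharTwo.two_eq_zero : (2 : F) = 0))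
  rw [← h.rotation_pairing hj] at hi
  have hr : Reach act T f (Ico j (j + 2)) x (act ((T (f (j + 1)) * T (f j)) ^ i) x) :=
    ⟨_, h.rotation_mem i, rfl⟩
  convert hr using 1
  exact (h.eq_of_step_pair hj (h.step_trans (h.step_symm (h.step_of_reach hsub hr)) hxy)
    (congrArg Prod.fst hi) (congrArg Prod.snd hi)).symm

theorem rotation_odd {j : ℕ} (hj : j + 1 ≤ 2 * m) :
    ∃ i, (T (f (j + 1)) * T (f j)) ^ (2 * i + 1) = 1 := by
  have hsub : Ico j (j + 2) ⊆ Iio (2 * m + 1) := fun k hk => by simp at hk ⊢; omega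
  obtain ⟨i, hi⟩ := (h.full_weight j).odd
  refine ⟨i, h.ext_act fun x => ?_⟩
  have h1 := h.rotation_pairing hj (2 * i + 1) x
  rw [hi] at h1
  rw [map_one, Module.End.one_apply]
  exact (h.eq_of_step_pair hj (h.step_of_mem hsub (h.rotation_mem _) x)
    (congrArg Prod.fst h1).symm (congrArg Prod.snd h1).symm).symm

theorem reach_singleton {j : ℕ} (hj : j ≤ 2 * m) {x y : M}
    (hxy : Step B q₀ f (Ico j (j + 1)) x y) : Reach act T f (Ico j (j + 1)) x y := by
  obtain ⟨a, ha, hxy, h1⟩ := hxy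
  have haj : a = Finsupp.single j (a j) := by
    ext k
    rw [Finsupp.single_apply]
    split_ifs with hk
    · rw [hk]
    · by_contra h0
      have := ha (Finsupp.mem_support_iff.2 h0)
      simp at this
      omega
  rw [haj, h.quad_single hj, Finsupp.linearCombination_single, map_smul, smul_eq_mul, sq] at h1
  rw [haj, Finsupp.linearCombination_single] at hxy
  rcases mul_eq_mul_left_iff.1 h1 with h2 | h2
  · refine ⟨T (f j), parabolic.mem (ρ := fun k => T (f k)) (by simp), ?_⟩
    rw [h.apply, h2, hxy]
  · rw [h2, zero_smul, add_zero] at hxy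
    rw [hxy]
    exact Reach.refl _ _

theorem exists_reach_next {I : Set ℕ} {k l : ℕ} (hkl : k + 1 = l ∨ l + 1 = k) (hk : k ≤ 2 * m)
    (hl : l ≤ 2 * m) (hkI : k ∈ I) {x : M} (hx : B x (f k) ≠ 0) :
    ∃ y, Reach act T f I x y ∧ B y (f l) ≠ 0 := by
  by_cases h1 : B x (f l) = 0
  · refine ⟨_, reach_transvection hkI x, ?_⟩
    rw [h.apply, map_add, LinearMap.add_apply, h1, zero_add, map_smul, LinearMap.smul_apply,
      smul_eq_mul]
    refine mul_ne_zero hx ?_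
    rcases hkl with rfl | rfl
    · rw [h.weight k hl]
      exact h.weight_ne_zero k
    · rw [h.weight_symm hk]
      exact h.weight_ne_zero l
  · exact ⟨x, Reach.refl _ _, h1⟩

theorem exists_reach_up {i k : ℕ} (hik : i ≤ k) (d : ℕ) : k + d ≤ 2 * m → ∀ {x : M},
    B x (f k) ≠ 0 → ∃ y, Reach act T f (Ico i (k + d)) x y ∧ B y (f (k + d)) ≠ 0 := by
  induction d with
  | zero => exact fun _ x hx => ⟨x, Reach.refl _ _, hx⟩
  | succ d ih =>
    intro hd x hx
    obtain ⟨y, hy, hy'⟩ := ih (by omega) hx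
    obtain ⟨z, hz, hz'⟩ := h.exists_reach_next (I := Ico i (k + (d + 1))) (l := k + (d + 1))
      (Or.inl (by omega)) (by omega) hd (by simp; omega) hy'
    exact ⟨z, (hy.mono (Ico_subset_Ico_right (by omega))).trans hz, hz'⟩

theorem exists_reach_second_last {i j : ℕ} (hj : j + 2 ≤ 2 * m) {x : M}
    (hx : Good B f (Ico i (j + 3)) x) :
    ∃ y, Reach act T f (Ico i (j + 3)) x y ∧ B y (f (j + 1)) ≠ 0 := by
  obtain ⟨k, hk, hx⟩ := hx
  simp only [mem_Ico] at hk
  by_cases h1 : k ≤ j + 1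
  · obtain ⟨d, hd⟩ := Nat.exists_eq_add_of_le h1
    obtain ⟨y, hy, hy'⟩ := h.exists_reach_up hk.1 d (by omega) hx
    exact ⟨y, hy.mono (Ico_subset_Ico_right (by omega)), by rwa [hd]⟩
  · exact h.exists_reach_next (Or.inr (by omega)) (by omega) (by omega) (by simp; omega) hx

theorem exists_reach_stepBy_triple {j : ℕ} (hj : j + 2 ≤ 2 * m) {x : M} {s t : F}
    (hst : s * B x (f j) + t * B x (f (j + 1)) = s ^ 2 + t ^ 2 + chainWeight b j * s * t) :
    ∃ y, Reach act T f (Ico j (j + 3)) x y ∧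
      StepBy B q₀ f (triple j s t (B x (f (j + 2)) + t * b)) x y := by
  have h1 : StepBy B q₀ f (Finsupp.single j s + Finsupp.single (j + 1) t) x
      (x + s • f j + t • f (j + 1)) := by
    constructor
    · simp [add_assoc]
    · rw [h.quad_pair (by omega)]
      simpa using hst
  refine ⟨act (T (f (j + 2))) (x + s • f j + t • f (j + 1)), ?_, ?_⟩
  · refine Reach.trans ?_ (reach_transvection (by simp) _)
    refine (h.reach_pair (by omega) ⟨_, ?_, h1⟩).mono (Ico_subset_Ico_right (by omega))
    exact add_mem (Finsupp.single_mem_supported F _ (by simp))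
      (Finsupp.single_mem_supported F _ (by simp))
  · have h2 := h.stepBy_trans h1 (h.stepBy_transvection hj _)
    have h3 : B (x + s • f j + t • f (j + 1)) (f (j + 2)) = B x (f (j + 2)) + t * b := by
      simp only [map_add, map_smul, LinearMap.add_apply, LinearMap.smul_apply,
        h.orth j (j + 2) (by omega) hj, h.weight (j + 1) hj, chainWeight_succ, smul_eq_mul]
      ring
    rwa [h3] at h2

theorem reach_of_pair_ne_zero {j : ℕ} (hj : j + 2 ≤ 2 * m) {x y : M}
    (hxy : Step B q₀ f (Ico j (j + 3)) x y) (hx : ¬(B x (f j) = 0 ∧ B x (f (j + 1)) = 0))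
    (hy : ¬(B y (f j) = 0 ∧ B y (f (j + 1)) = 0)) : Reach act T f (Ico j (j + 3)) x y := by
  obtain ⟨a, ha, hxy⟩ := hxy
  obtain ⟨s, t, s', t', h1, h2, ht⟩ := (h.full_weight j).exists_shift_eq (h.weight_ne_zero j) hx hy
    ((B x (f (j + 2)) + B y (f (j + 2)) + a (j + 2)) / b)
  obtain ⟨u, hu, hu'⟩ := h.exists_reach_stepBy_triple hj h1
  obtain ⟨v, hv, hv'⟩ := h.exists_reach_stepBy_triple hj h2
  refine (hu.trans (Reach.mono (Ico_subset_Ico_right (by omega)) (h.reach_pair (by omega)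
    ⟨_, ?_, h.stepBy_trans (h.stepBy_trans (h.stepBy_symm hu') hxy) hv'⟩))).trans hv.symm
  refine mem_supported_Ico_of_cancel le_rfl ha ?_
  have hb := h.b_ne_zero
  rw [ht]
  field_simp
  linear_combination (B x (f (j + 2)) + B y (f (j + 2)) + a (j + 2) + t * b) *
    (CharTwo.two_eq_zero : (2 : F) = 0)

theorem realizes_triple {j : ℕ} (hj : j + 2 ≤ 2 * m) : Realizes B act T f q₀ (Ico j (j + 3)) := by
  intro x y hxy hx hy
  obtain ⟨u, hu, hu'⟩ := h.exists_reach_second_last hj hx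
  obtain ⟨v, hv, hv'⟩ := h.exists_reach_second_last hj hy
  refine h.reach_of_reach (fun k hk => by simp at hk ⊢; omega) hu hv hxy fun huv => ?_
  exact h.reach_of_pair_ne_zero hj huv (fun h0 => hu' h0.2) (fun h0 => hv' h0.2)

theorem stepBy_triple {j : ℕ} (hj : j + 3 ≤ 2 * m) {x : M} {s t z : F}
    (hst : s * B x (f (j + 1)) + t * B x (f (j + 2)) + z * B x (f (j + 3)) =
      s ^ 2 + t ^ 2 + z ^ 2 + b * s * t + b * t * z) :
    StepBy B q₀ f (triple (j + 1) s t z) x (x + s • f (j + 1) + t • f (j + 2) + z • f (j + 3)) := by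
  constructor
  · simp [triple, add_assoc]
  · rw [triple, h.quad_coord_add, h.quad_pair (by omega), h.quad_single hj]
    simp only [map_add, map_smul, Finsupp.linearCombination_single, LinearMap.add_apply,
      LinearMap.smul_apply, h.orth (j + 1) (j + 1 + 2) (by omega) hj, h.weight (j + 1 + 1) hj,
      chainWeight_succ, smul_eq_mul]
    linear_combination hst

theorem realizes_step {i j : ℕ} (hij : i ≤ j) (hj : j + 3 ≤ 2 * m)
    (hr : Realizes B act T f q₀ (Ico i (j + 3))) : Realizes B act T f q₀ (Ico i (j + 4)) := by
  intro x y hxy hx hy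
  obtain ⟨u, hu, hu'⟩ := h.exists_reach_second_last (j := j + 1) hj hx
  obtain ⟨v, hv, hv'⟩ := h.exists_reach_second_last (j := j + 1) hj hy
  refine h.reach_of_reach (fun k hk => by simp at hk ⊢; omega) hu hv hxy ?_
  clear hu hv hxy hx hy x y
  rintro ⟨a, ha, huv⟩
  have move {x : M} (hx : B x (f (j + 2)) ≠ 0) {s t z : F}
      (h1 : s * B x (f (j + 1)) + t * B x (f (j + 2)) + z * B x (f (j + 3)) =
        s ^ 2 + t ^ 2 + z ^ 2 + b * s * t + b * t * z)
      (h2 : B x (f (j + 2)) + b * s + b * z ≠ 0) :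
      ∃ y, StepBy B q₀ f (triple (j + 1) s t z) x y ∧ Reach act T f (Ico i (j + 4)) x y ∧
        Good B f (Ico i (j + 3)) y := by
    have h3 := h.stepBy_triple hj h1
    have h4 : B (x + s • f (j + 1) + t • f (j + 2) + z • f (j + 3)) (f (j + 2)) ≠ 0 := by
      simp only [map_add, map_smul, LinearMap.add_apply, LinearMap.smul_apply, h.alt,
        h.weight (j + 1) (by omega), h.weight_symm (k := j + 2) hj, chainWeight_succ, smul_eq_mul]
      intro h0
      exact h2 (by linear_combination h0)
    refine ⟨_, h3, ?_, j + 2, by simp; omega, h4⟩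
    refine (h.realizes_triple (j := j + 1) hj _ _ ⟨_, triple_mem _ _ _ _, h3⟩ ⟨j + 2, by simp, hx⟩
      ⟨j + 2, by simp, h4⟩).mono (Ico_subset_Ico_left (by omega))
  obtain ⟨s, t, z, s', t', z', h1, h2, h3, h4, hz⟩ := h.full.exists_step_step h.b_ne_zero h.four_le
    (u := B u (f (j + 3))) (u' := B v (f (j + 3))) (fun h0 => hu' h0.2) (fun h0 => hv' h0.2)
    (a (j + 3))
  obtain ⟨x, hux, hux', hx⟩ := move hu' h1 h3
  obtain ⟨y, hvy, hvy', hy⟩ := move hv' h2 h4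
  refine (hux'.trans (Reach.mono (Ico_subset_Ico_right (by omega)) (hr x y
    ⟨_, ?_, h.stepBy_trans (h.stepBy_trans (h.stepBy_symm hux) huv) hvy⟩ hx hy))).trans hvy'.symm
  refine mem_supported_Ico_of_cancel (j := j + 1) (by omega) ha ?_
  rw [hz]
  linear_combination (z + a (j + 3)) * (CharTwo.two_eq_zero : (2 : F) = 0)

theorem realizes_Ico (i d : ℕ) (hd : i + d ≤ 2 * m + 1) : Realizes B act T f q₀ (Ico i (i + d)) := by
  induction d with
  | zero =>
    rintro x y ⟨a, ha, rfl, -⟩ - -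
    have : a = 0 := by simpa using ha
    simpa [this] using Reach.refl _ _
  | succ d ih =>
    match d, ih with
    | 0, _ => exact fun x y hxy _ _ => h.reach_singleton (by omega) hxy
    | 1, _ => exact fun x y hxy _ _ => h.reach_pair (by omega) hxy
    | 2, _ => exact h.realizes_triple (by omega)
    | d + 3, ih => exact h.realizes_step (j := i + d) (by omega) (by omega) (ih (by omega))

theorem pairing_linearCombination {a : ℕ →₀ F}
    (ha : a ∈ Finsupp.supported F F (Iio (2 * m + 1))) :
    B (f 0) (Finsupp.linearCombination F f a) = chainWeight b 0 * a 1 ∧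
    ∀ k, k + 1 ≤ 2 * m → B (f (k + 1)) (Finsupp.linearCombination F f a) =
      chainWeight b k * a k + chainWeight b (k + 1) * a (k + 2) := by
  rw [Finsupp.supported_eq_span_single] at ha
  induction ha using Submodule.span_induction with
  | mem a ha =>
    obtain ⟨l, hl, rfl⟩ := ha
    simp only [mem_Iio] at hl
    simp only [Finsupp.linearCombination_single, one_smul, Finsupp.single_apply]
    constructor
    · rcases Nat.lt_trichotomy l 1 with h1 | rfl | h1
      · obtain rfl : l = 0 := by omega
        simp [h.alt]
      · simp [h.weight 0 (by omega)]
      · simp [h.orth 0 l h1 (by omega), show l ≠ 1 by omega]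
    · intro k hk
      by_cases h1 : l = k
      · subst h1; simp [h.weight_symm hk]
      by_cases h2 : l = k + 1
      · subst h2; simp [h.alt]
      by_cases h3 : l = k + 2
      · subst h3; simp [h.weight (k + 1) (by omega)]
      rw [if_neg h1, if_neg h3, mul_zero, mul_zero, add_zero]
      rcases Nat.lt_or_ge l k with h4 | h4
      · exact h.orth_symm (by omega) hk
      · exact h.orth _ _ (by omega) (by omega)
  | zero => simp
  | add a c _ _ h1 h2 =>
    refine ⟨?_, fun k hk => ?_⟩
    · rw [map_add, map_add, h1.1, h2.1, Finsupp.add_apply]; ring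
    · rw [map_add, map_add, h1.2 k hk, h2.2 k hk, Finsupp.add_apply, Finsupp.add_apply]; ring
  | smul r a _ h1 =>
    refine ⟨?_, fun k hk => ?_⟩
    · rw [map_smul, map_smul, h1.1, Finsupp.smul_apply, smul_eq_mul, smul_eq_mul]; ring
    · rw [map_smul, map_smul, h1.2 k hk, Finsupp.smul_apply, Finsupp.smul_apply]
      simp only [smul_eq_mul]; ring

theorem one_add_mul_ne_zero : 1 + (m : F) * b ≠ 0 := by
  rcases Nat.even_or_odd m with hm | hm
  · rw [(CharP.cast_eq_zero_iff F 2 m).2 hm.two_dvd]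
    simp
  · obtain ⟨r, rfl⟩ := hm
    rw [Nat.cast_add, Nat.cast_mul, Nat.cast_two, CharTwo.two_eq_zero, Nat.cast_one, zero_mul,
      zero_add, one_mul, Ne, CharTwo.add_eq_zero]
    exact h.b_ne_one.symm

theorem coord_eq_zero {c : ℕ →₀ F} (hc : c ∈ Finsupp.supported F F (Iio (2 * m + 1)))
    (h0 : Finsupp.linearCombination F f c = 0)
    (h1 : Finsupp.linearCombination F (fun _ => (1 : F)) c = 0) : c = 0 := by
  have hb := h.b_ne_zero
  obtain ⟨hp0, hp⟩ := h.pairing_linearCombination hc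
  simp only [h0, map_zero] at hp0 hp
  have hodd (i : ℕ) (hi : i < m) : c (2 * i + 1) = 0 := by
    induction i with
    | zero => simpa [h.weight_ne_zero 0] using hp0.symm
    | succ i ih =>
      have h2 := hp (2 * i + 1) (by omega)
      rw [ih (by omega), mul_zero, zero_add] at h2
      exact (mul_eq_zero.1 h2.symm).resolve_left (h.weight_ne_zero _)
  have heven (i : ℕ) (hi : i < m) : c (2 * i + 2) = b * c 0 := by
    induction i with
    | zero =>
      have h2 := hp 0 (by omega)
      simp only [chainWeight, if_true, if_neg one_ne_zero, zero_add] at h2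
      refine mul_left_cancel₀ hb ?_
      linear_combination -h2 - b ^ 2 * c 0 * (CharTwo.two_eq_zero : (2 : F) = 0)
    | succ i ih =>
      have h2 := hp (2 * i + 2) (by omega)
      rw [chainWeight_succ, chainWeight_succ, ih (by omega)] at h2
      refine mul_left_cancel₀ hb ?_
      rw [mul_add, mul_one]
      linear_combination -h2 - b ^ 2 * c 0 * (CharTwo.two_eq_zero : (2 : F) = 0)
  have hsum : (1 + (m : F) * b) * c 0 = 0 := by
    rw [← h1, Finsupp.linearCombination_apply, Finsupp.sum_of_support_subset
      (s := Finset.range (2 * m + 1)) _ (fun k hk => by simpa using hc hk) _ (by simp)]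
    simp only [smul_eq_mul, mul_one]
    rw [sum_range_two_mul_add_one, Finset.sum_congr rfl (g := fun _ => b * c 0)
      fun i hi => by rw [hodd i (by simpa using hi), heven i (by simpa using hi), zero_add]]
    simp
    ring
  have hc0 : c 0 = 0 := (mul_eq_zero.1 hsum).resolve_left h.one_add_mul_ne_zero
  ext k
  by_cases hk : k ∈ Iio (2 * m + 1)
  · simp only [mem_Iio] at hk
    obtain ⟨i, hi⟩ := Nat.even_or_odd' k
    rcases hi with rfl | rfl
    · match i with
      | 0 => exact hc0
      | i + 1 => simpa [hc0, mul_add] using heven i (by omega)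
    · exact hodd i (by omega)
  · by_contra h2
    exact hk (hc (Finsupp.mem_support_iff.2 h2))

theorem mem_parabolic_of_step (d i : ℕ) (hd : i + d ≤ 2 * m) : ∀ g,
    (∀ x, Step B q₀ f (Ico i (i + d)) x (act g x)) →
    g ∈ parabolic (fun k => T (f k)) (Ico i (i + d)) := by
  induction d with
  | zero =>
    intro g hg
    have : g = 1 := h.ext_act fun x => by
      obtain ⟨a, ha, hx, -⟩ := hg x
      have ha : a = 0 := by simpa using ha
      simpa [ha] using hx
    exact this ▸ one_mem _
  | succ d ih =>
    intro g hg
    have hsub : Ico i (i + (d + 1)) ⊆ Iio (2 * m + 1) := fun k hk => by simp at hk ⊢; omega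
    have hmem : i + d ∈ Ico i (i + (d + 1)) := by simp
    have hw : B (f (i + d + 1)) (f (i + d)) = chainWeight b (i + d) := h.weight_symm (by omega)
    obtain ⟨p, hp, hpu⟩ := h.realizes_Ico i (d + 1) (by omega) _ _ (hg (f (i + d + 1)))
      ⟨i + d, hmem, by rw [hw]; exact h.weight_ne_zero _⟩ (by
        by_contra h1
        simp only [Good, not_exists, not_and, not_not] at h1
        obtain ⟨a, ha, h2, -⟩ := hg (f (i + d))
        apply h.weight_ne_zero (i + d)
        rw [← hw, ← h.preserves g, h2, map_add, h1 _ hmem, pairing_eq_zero ha h1, add_zero])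
    have hfix : act (p⁻¹ * g) (f (i + d + 1)) = f (i + d + 1) := by
      rw [IsTransvectionFamily.act_mul, ← hpu, IsTransvectionFamily.act_inv_act]
    rw [← (parabolic _ _).mul_mem_cancel_left (inv_mem hp)]
    refine parabolic.mono (Ico_subset_Ico_right (by omega)) (ih (by omega) (p⁻¹ * g) fun x => ?_)
    obtain ⟨a, ha, h1⟩ : Step B q₀ f (Ico i (i + (d + 1))) x (act (p⁻¹ * g) x) := by
      rw [IsTransvectionFamily.act_mul]
      exact h.step_trans (hg x) (h.step_of_mem hsub (inv_mem hp) _)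
    refine ⟨a, mem_supported_of_eq_zero ha fun k hk => ?_, h1⟩
    by_cases hk' : k = i + d
    · right
      subst hk'
      have h2 := h.preserves (p⁻¹ * g) (f (i + d + 1)) x
      rw [hfix, h1.1, map_add, add_eq_left,
        (h.pairing_linearCombination (Finsupp.supported_mono hsub ha)).2 _ (by omega)] at h2
      have h3 : a (i + d + 2) = 0 := by
        by_contra h3
        have := ha (Finsupp.mem_support_iff.2 h3)
        simp at this
        omega
      rw [h3, mul_zero, add_zero] at h2
      exact (mul_eq_zero.1 h2).resolve_left (h.weight_ne_zero _)
    · left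
      simp at hk ⊢
      omega

theorem inf_parabolic_le {i j : ℕ} (hij : i < j) (hj : j < 2 * m + 1) :
    parabolic (fun k => T (f k)) (Ico i j) ⊓ parabolic (fun k => T (f k)) (Ico (i + 1) (j + 1)) ≤
      parabolic (fun k => T (f k)) (Ico (i + 1) j) := by
  rintro g ⟨hg, hg'⟩
  obtain ⟨d, rfl⟩ := Nat.exists_eq_add_of_le (show i + 1 ≤ j from hij)
  refine h.mem_parabolic_of_step d (i + 1) (by omega) g fun x => ?_
  have hs : Ico i (i + 1 + d) ⊆ Iio (2 * m + 1) := fun k hk => by simp at hk ⊢; omega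
  have hs' : Ico (i + 1) (i + 1 + d + 1) ⊆ Iio (2 * m + 1) := fun k hk => by simp at hk ⊢; omega
  obtain ⟨a, ha, h1⟩ := h.step_of_mem hs hg x
  obtain ⟨c, hc, h2⟩ := h.step_of_mem hs' hg' x
  have h3 : Finsupp.linearCombination F f a = Finsupp.linearCombination F f c :=
    add_left_cancel (h1.1.symm.trans h2.1)
  have h4 : Finsupp.linearCombination F f (a + c) = 0 := by
    rw [map_add, h3, IsTransvectionFamily.add_self F]
  have h5 : quad q₀ f (a + c) = 0 := by
    rw [h.quad_coord_add, ← h1.2, ← h2.2, h3, h.alt, add_zero, CharTwo.add_self_eq_zero]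
  have h6 : q₀ 0 = 0 := by simpa using h.quad_smul 0 0
  rw [quad, h4, h6, add_zero, sq_eq_zero_iff] at h5
  have h7 := h.coord_eq_zero (add_mem (Finsupp.supported_mono hs ha)
    (Finsupp.supported_mono hs' hc)) h4 h5
  refine ⟨a, mem_supported_of_eq_zero ha fun k hk => ?_, h1⟩
  by_cases hk' : k = i
  · right
    have h8 := DFunLike.congr_fun h7 k
    have h9 : c k = 0 := by
      by_contra h9
      have := hc (Finsupp.mem_support_iff.2 h9)
      simp at this
      omega
    simpa [h9] using h8
  · left
    simp at hk ⊢
    omega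

theorem step_first (v : M) : Step B q₀ f (Iio (2 * m + 1)) (f 0) v := by
  obtain ⟨a, ha, h1⟩ := h.span (v - f 0)
  let r : ℕ →₀ F := Finsupp.single 0 1 + ∑ i ∈ Finset.range m, Finsupp.single (2 * i + 2) b
  have hr : r ∈ Finsupp.supported F F (Iio (2 * m + 1)) := by
    refine add_mem (Finsupp.single_mem_supported F _ (by simp)) (sum_mem fun i hi => ?_)
    refine Finsupp.single_mem_supported F _ ?_
    simp at hi ⊢
    omega
  have hr0 : Finsupp.linearCombination F f r = 0 := by
    rw [← h.rel]
    simp [r, Finset.smul_sum]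
  have hr1 : Finsupp.linearCombination F (fun _ => (1 : F)) r = 1 + m * b := by
    simp [r]
  have hq0 : q₀ 0 = 0 := by simpa using h.quad_smul 0 0
  obtain ⟨e, he⟩ := FiniteField.isSquare_of_char_two (ringChar.eq F 2)
    ((B (f 0) (v - f 0) + quad q₀ f a) / (1 + m * b) ^ 2)
  rw [div_eq_iff (pow_ne_zero _ h.one_add_mul_ne_zero)] at he
  refine ⟨a + e • r, add_mem ha (Submodule.smul_mem _ _ hr), ?_, ?_⟩
  · rw [map_add, map_smul, hr0, smul_zero, add_zero, h1, add_sub_cancel]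
  · rw [h.quad_coord_add]
    have : quad q₀ f (e • r) = e * e * (1 + m * b) ^ 2 := by
      rw [quad, map_smul, map_smul, hr0, hr1, smul_zero, hq0, add_zero, smul_eq_mul]
      ring
    rw [this, map_add, map_smul, hr0, smul_zero, add_zero, h1, map_zero, add_zero, ← he]
    linear_combination -quad q₀ f a * (CharTwo.two_eq_zero : (2 : F) = 0)

theorem parabolic_eq_top [FiniteDimensional F M] (hm : 1 ≤ m) :
    parabolic (fun k => T (f k)) (Iio (2 * m + 1)) = ⊤ := by
  refine h.eq_top fun v => ?_
  by_cases hv : v = 0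
  · have : T v = 1 := h.ext_act fun x => by simp [h.apply, hv]
    exact this ▸ one_mem _
  · have hr := h.realizes_Ico 0 (2 * m + 1) (by omega)
    have hI : Ico 0 (0 + (2 * m + 1)) = Iio (2 * m + 1) := by ext; simp
    rw [hI] at hr
    obtain ⟨g, hg, rfl⟩ := hr _ _ (h.step_first v)
      ⟨1, by simp; omega, by rw [h.weight 0 (by omega)]; exact h.weight_ne_zero 0⟩ (by
        by_contra h1
        simp only [Good, not_exists, not_and, not_not] at h1
        refine hv (h.nondeg v fun y => ?_)
        obtain ⟨a, ha, rfl⟩ := h.span y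
        exact pairing_eq_zero ha h1)
    rw [← h.conj]
    exact mul_mem (mul_mem hg (parabolic.mem (ρ := fun k => T (f k)) (by simp))) (inv_mem hg)

theorem isOddStringCGroup [FiniteDimensional F M] (hm : 1 ≤ m) :
    IsOddStringCGroup (2 * m + 1) (fun k => T (f k)) := by
  have hcomm (i j : ℕ) (hij : i + 1 < j) (hj : j < 2 * m + 1) : Commute (T (f i)) (T (f j)) :=
    h.commute (h.orth i j hij (by omega))
  refine ⟨fun i _ => h.mul_self _, h.parabolic_eq_top hm, hcomm, fun I J hI hJ => ?_,
    fun i hi => ?_, fun i _ hi => h.rotation_odd (by omega)⟩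
  · exact parabolic.inf_le_of_intervals hcomm (fun i j hij hj => h.inf_parabolic_le hij hj)
      (2 * m + 1) 0 (by omega) I J (hI.trans fun k hk => by simpa using hk)
      (hJ.trans fun k hk => by simpa using hk)
  · refine h.not_commute ?_
    rw [h.weight i (by omega)]
    exact h.weight_ne_zero i

end IsTransvectionChain

namespace SymplecticChain

variable {F : Type*} [Field F] {m : ℕ}

/-- The standard symplectic form. -/
def form (F : Type*) [Field F] (m : ℕ) : LinearMap.BilinForm F (Fin m ⊕ Fin m → F) :=
  Matrix.toBilin' (Matrix.J (Fin m) F)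

/-- The action of the symplectic group on column vectors. -/
def act (F : Type*) [Field F] (m : ℕ) :
    Matrix.symplecticGroup (Fin m) F →* Module.End F (Fin m ⊕ Fin m → F) :=
  (Matrix.toLinAlgEquiv' : Matrix (Fin m ⊕ Fin m) (Fin m ⊕ Fin m) F ≃ₐ[F] _).toMonoidHom.comp
    (Matrix.symplecticGroup (Fin m) F).subtype

theorem act_apply (g : Matrix.symplecticGroup (Fin m) F) (x : Fin m ⊕ Fin m → F) :
    act F m g x = (g : Matrix _ _ F).mulVec x := by
  simp [act]

theorem mem_symplecticGroup_iff {A : Matrix (Fin m ⊕ Fin m) (Fin m ⊕ Fin m) F} :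
    A ∈ Matrix.symplecticGroup (Fin m) F ↔
      ∀ x y, form F m (A.mulVec x) (A.mulVec y) = form F m x y := by
  rw [SymplecticGroup.mem_iff', ← Matrix.toBilin'.injective.eq_iff, LinearMap.ext_iff₂]
  refine forall₂_congr fun x y => ?_
  simp only [form, Matrix.toBilin'_apply', Matrix.dotProduct_mulVec, Matrix.vecMul_mulVec,
    Matrix.vecMul_vecMul]

variable [CharP F 2]

theorem form_apply (x y : Fin m ⊕ Fin m → F) :
    form F m x y = ∑ i, (x (Sum.inl i) * y (Sum.inr i) + x (Sum.inr i) * y (Sum.inl i)) := by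
  simp [form, Matrix.toBilin'_apply', Matrix.J, Matrix.mulVec, dotProduct, Matrix.fromBlocks,
    Finset.sum_add_distrib, Matrix.one_apply, CharTwo.neg_eq]

theorem form_self (x : Fin m ⊕ Fin m → F) : form F m x x = 0 := by
  rw [form_apply]
  exact Finset.sum_eq_zero fun i _ => by rw [mul_comm, CharTwo.add_self_eq_zero]

theorem form_symm (x y : Fin m ⊕ Fin m → F) : form F m x y = form F m y x := by
  rw [form_apply, form_apply]
  exact Finset.sum_congr rfl fun i _ => by ring

/-- The symplectic transvection along a vector. -/
def transvection (v : Fin m ⊕ Fin m → F) : Matrix.symplecticGroup (Fin m) F :=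
  ⟨1 + Matrix.vecMulVec v ((Matrix.J (Fin m) F).mulVec v), by
    have h (x : Fin m ⊕ Fin m → F) : (1 + Matrix.vecMulVec v
        ((Matrix.J (Fin m) F).mulVec v)).mulVec x = x + form F m x v • v := by
      rw [Matrix.add_mulVec, Matrix.one_mulVec, Matrix.vecMulVec_mulVec, dotProduct_comm, form,
        Matrix.toBilin'_apply']
      simp
    rw [mem_symplecticGroup_iff]
    intro x y
    rw [h, h]
    simp only [map_add, map_smul, LinearMap.add_apply, LinearMap.smul_apply, smul_eq_mul,
      form_self, form_symm v y]
    linear_combination form F m x v * form F m y v * (CharTwo.two_eq_zero : (2 : F) = 0)⟩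

theorem act_transvection (v x : Fin m ⊕ Fin m → F) :
    act F m (transvection v) x = x + form F m x v • v := by
  rw [act_apply, transvection, Matrix.add_mulVec, Matrix.one_mulVec, Matrix.vecMulVec_mulVec,
    dotProduct_comm, form, Matrix.toBilin'_apply']
  simp

/-- The vectors of the first half of the standard basis, extended by zero. -/
def basisFst (F : Type*) [Field F] (m i : ℕ) : Fin m ⊕ Fin m → F :=
  Sum.elim (fun j => if j.val = i then 1 else 0) 0

/-- The vectors of the second half of the standard basis, extended by zero. -/
def basisSnd (F : Type*) [Field F] (m i : ℕ) : Fin m ⊕ Fin m → F :=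
  Sum.elim 0 (fun j => if j.val = i then 1 else 0)

theorem form_basisFst (x : Fin m ⊕ Fin m → F) (i : Fin m) :
    form F m x (basisFst F m i) = x (Sum.inr i) := by
  simp [form_apply, basisFst, Fin.val_inj]

theorem form_basisSnd (x : Fin m ⊕ Fin m → F) (i : Fin m) :
    form F m x (basisSnd F m i) = x (Sum.inl i) := by
  simp [form_apply, basisSnd, Fin.val_inj]

theorem isTransvectionFamily : IsTransvectionFamily (form F m) (act F m) transvection where
  inj := Matrix.toLinAlgEquiv'.injective.comp Subtype.val_injective
  alt := form_self
  nondeg x hx := by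
    ext (i | i)
    · rw [← form_basisSnd x i, hx, Pi.zero_apply]
    · rw [← form_basisFst x i, hx, Pi.zero_apply]
  preserves g x y := by
    rw [act_apply, act_apply]
    exact mem_symplecticGroup_iff.1 g.2 x y
  apply := act_transvection

theorem form_basisFst_basisFst (i j : ℕ) : form F m (basisFst F m i) (basisFst F m j) = 0 := by
  simp [form_apply, basisFst]

theorem form_basisSnd_basisSnd (i j : ℕ) : form F m (basisSnd F m i) (basisSnd F m j) = 0 := by
  simp [form_apply, basisSnd]

theorem form_basisFst_basisSnd (i : ℕ) {j : ℕ} (hj : j < m) :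
    form F m (basisFst F m i) (basisSnd F m j) = if j = i then 1 else 0 := by
  simpa [basisFst] using form_basisSnd (basisFst F m i) ⟨j, hj⟩

theorem form_basisSnd_basisFst (i : ℕ) {j : ℕ} (hj : j < m) :
    form F m (basisSnd F m j) (basisFst F m i) = if j = i then 1 else 0 := by
  rw [form_symm, form_basisFst_basisSnd i hj]

/-- The vectors of the transvections that generate the symplectic group. -/
def chain (m : ℕ) (b : F) (k : ℕ) : Fin m ⊕ Fin m → F :=
  if k = 0 then b • basisFst F m 0
  else if k % 2 = 0 then basisFst F m (k / 2) + basisFst F m (k / 2 - 1)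
  else b • basisSnd F m (k / 2)

omit [CharP F 2] in
theorem chain_zero (b : F) : chain m b 0 = b • basisFst F m 0 := if_pos rfl

omit [CharP F 2] in
theorem chain_odd (b : F) (i : ℕ) : chain m b (2 * i + 1) = b • basisSnd F m i := by
  rw [chain, if_neg (by omega), if_neg (by omega), show (2 * i + 1) / 2 = i by omega]

omit [CharP F 2] in
theorem chain_even (b : F) (i : ℕ) :
    chain m b (2 * i + 2) = basisFst F m (i + 1) + basisFst F m i := by
  rw [chain, if_neg (by omega), if_pos (by omega), show (2 * i + 2) / 2 = i + 1 by omega,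
    Nat.add_sub_cancel]

omit [CharP F 2] in
theorem chain_cases {P : ℕ → Prop} (h0 : P 0) (h1 : ∀ i, P (2 * i + 1)) (h2 : ∀ i, P (2 * i + 2))
    (k : ℕ) : P k := by
  obtain ⟨i, rfl | rfl⟩ := Nat.even_or_odd' k
  · match i with
    | 0 => exact h0
    | i + 1 => exact h2 i
  · exact h1 i

theorem sum_chain (b : F) (n : ℕ) :
    ∑ i ∈ Finset.range n, chain m b (2 * i + 2) = basisFst F m n + basisFst F m 0 := by
  induction n with
  | zero => rw [Finset.sum_range_zero, IsTransvectionFamily.add_self F]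
  | succ n ih =>
    rw [Finset.sum_range_succ, ih, chain_even, add_comm (basisFst F m (n + 1)), ← add_assoc,
      add_right_comm _ _ (basisFst F m n), IsTransvectionFamily.add_self F, zero_add, add_comm]

omit [CharP F 2] in
theorem span_chain {b : F} (hb : b ≠ 0) (x : Fin m ⊕ Fin m → F) :
    x ∈ Submodule.span F (chain m b '' Iio (2 * m + 1)) := by
  have hmem {k : ℕ} (hk : k < 2 * m + 1) :
      chain m b k ∈ Submodule.span F (chain m b '' Iio (2 * m + 1)) :=
    Submodule.subset_span ⟨k, hk, rfl⟩
  have hfst (i : ℕ) (hi : i < m) :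
      basisFst F m i ∈ Submodule.span F (chain m b '' Iio (2 * m + 1)) := by
    induction i with
    | zero =>
      have := hmem (k := 0) (by omega)
      rwa [chain_zero, Submodule.smul_mem_iff _ hb] at this
    | succ i ih =>
      have := hmem (k := 2 * i + 2) (by omega)
      rw [chain_even] at this
      exact (Submodule.add_mem_iff_left _ (ih (by omega))).1 this
  have hsnd (i : ℕ) (hi : i < m) :
      basisSnd F m i ∈ Submodule.span F (chain m b '' Iio (2 * m + 1)) := by
    have := hmem (k := 2 * i + 1) (by omega)
    rwa [chain_odd, Submodule.smul_mem_iff _ hb] at this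
  have hx : x = ∑ i : Fin m, (x (Sum.inl i) • basisFst F m i + x (Sum.inr i) • basisSnd F m i) := by
    ext (i | i) <;> simp [basisFst, basisSnd, Fin.val_inj]
  rw [hx]
  exact sum_mem fun i _ => add_mem (Submodule.smul_mem _ _ (hfst i i.2))
    (Submodule.smul_mem _ _ (hsnd i i.2))

theorem isTransvectionChain [Fintype F] {b : F} (hb : b ≠ 0) (hb' : b ≠ 1)
    (h : IsFullRotation b) (h' : IsFullRotation (b ^ 2)) (h4 : 4 ≤ Fintype.card F) :
    IsTransvectionChain (form F m) (act F m) transvection m b (chain m b)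
      (fun x => ∑ i, x (Sum.inl i) * x (Sum.inr i)) where
  toIsTransvectionFamily := isTransvectionFamily
  b_ne_zero := hb
  b_ne_one := hb'
  full := h
  full_sq := h'
  four_le := h4
  quad_add x y := by
    rw [form_apply, ← Finset.sum_add_distrib, ← Finset.sum_add_distrib]
    refine Finset.sum_congr rfl fun i _ => ?_
    simp only [Pi.add_apply]
    ring
  quad_smul c x := by
    rw [Finset.mul_sum]
    refine Finset.sum_congr rfl fun i _ => ?_
    simp only [Pi.smul_apply, smul_eq_mul]
    ring
  quad_chain k _ := by
    induction k using chain_cases with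
    | h0 => simp [chain_zero, basisFst]
    | h1 i => simp [chain_odd, basisSnd]
    | h2 i => simp [chain_even, basisFst]
  weight k hk := by
    induction k using chain_cases with
    | h0 =>
      rw [chain_zero, chain_odd b 0, map_smul, map_smul, LinearMap.smul_apply,
        form_basisFst_basisSnd _ (by omega)]
      simp [chainWeight, sq]
    | h1 i =>
      rw [chain_odd, chain_even, map_smul, LinearMap.smul_apply, map_add,
        form_basisSnd_basisFst _ (by omega), form_basisSnd_basisFst _ (by omega)]
      simp [chainWeight]
    | h2 i =>
      rw [chain_even, show 2 * i + 2 + 1 = 2 * (i + 1) + 1 by ring, chain_odd, map_smul, map_add,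
        LinearMap.add_apply, form_basisFst_basisSnd _ (by omega),
        form_basisFst_basisSnd _ (by omega)]
      simp [chainWeight]
  orth k l hkl hl := by
    induction k using chain_cases with
    | h0 =>
      induction l using chain_cases with
      | h0 => omega
      | h1 j =>
        rw [chain_zero, chain_odd, map_smul, map_smul, LinearMap.smul_apply,
          form_basisFst_basisSnd _ (by omega), if_neg (by omega), smul_zero, smul_zero]
      | h2 j => simp [chain_zero, chain_even, form_basisFst_basisFst]
    | h1 i =>
      induction l using chain_cases with
      | h0 => omega
      | h1 j => simp [chain_odd, form_basisSnd_basisSnd]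
      | h2 j =>
        rw [chain_odd, chain_even, map_smul, LinearMap.smul_apply, map_add,
          form_basisSnd_basisFst _ (by omega), form_basisSnd_basisFst _ (by omega),
          if_neg (by omega), if_neg (by omega), add_zero, smul_zero]
    | h2 i =>
      induction l using chain_cases with
      | h0 => omega
      | h1 j =>
        rw [chain_even, chain_odd, map_smul, map_add, LinearMap.add_apply,
          form_basisFst_basisSnd _ (by omega), form_basisFst_basisSnd _ (by omega),
          if_neg (by omega), if_neg (by omega), add_zero, smul_zero]
      | h2 j => simp [chain_even, form_basisFst_basisFst]
  span x := (Finsupp.mem_span_image_iff_linearCombination F).1 (span_chain hb x)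
  rel := by
    have hm : basisFst F m m = 0 := by
      ext (i | i)
      · simp [basisFst, i.2.ne]
      · simp [basisFst]
    rw [sum_chain, hm, zero_add, chain_zero, IsTransvectionFamily.add_self F]

end SymplecticChain

theorem IsOddStringCGroup.exists_of_le {G : Type*} [Group G] {n N : ℕ} (hn : 3 ≤ n) (hN : n ≤ N)
    {ρ : ℕ → G} (h : IsOddStringCGroup N ρ) : ∃ ρ' : ℕ → G, IsOddStringCGroup n ρ' := by
  induction N, hN using Nat.le_induction generalizing ρ with
  | base => exact ⟨ρ, h⟩
  | succ N hN ih => exact ih (h.mergeFirst (hn.trans hN))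

end

theorem IsOddStringCGroup.isStringCGroupRep {G : Type*} [Group G] {n : ℕ} (hn : 2 ≤ n)
    {ρ : ℕ → G} (h : IsOddStringCGroup n ρ) : IsStringCGroupRep fun i : Fin n => ρ i := by
  have himage (I : Set (Fin n)) : Subgroup.closure ((fun i : Fin n => ρ i) '' I) =
      parabolic ρ (Fin.val '' I) := by
    rw [parabolic, Set.image_image]
  have hsub (I : Set (Fin n)) : Fin.val '' I ⊆ Set.Iio n := by
    rintro _ ⟨i, -, rfl⟩
    exact i.2
  refine ⟨fun i => orderOf_eq_prime ((pow_two _).trans (h.sq i i.2)) fun (h1 : ρ i = 1) => ?_, ?_,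
    fun i j hij => h.comm i j hij j.2, fun I J => ?_⟩
  · by_cases hi : i.val + 1 < n
    · exact h.noncomm i hi (h1 ▸ Commute.one_left _)
    · have h2 := h.noncomm (i - 1) (by omega)
      rw [Nat.sub_add_cancel (by omega), h1] at h2
      exact h2 (Commute.one_right _)
  · rw [← Set.image_univ, himage, Set.image_univ, Fin.range_val, h.gen]
  · rw [himage, himage, himage, Set.image_inter Fin.val_injective]
    exact le_antisymm (h.inter _ _ (hsub I) (hsub J))
      (le_inf (parabolic.mono Set.inter_subset_left) (parabolic.mono Set.inter_subset_right))

/-- For `k ≥ 2`, `m ≥ 2` and `3 ≤ n ≤ 2m + 1`, the symplectic group `Sp(2m, F)`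
over the field with `2^k` elements has a string C-group representation of rank `n`. -/
theorem symplectic_exists_all_ranks (k m : ℕ) (hk : 2 ≤ k) (hm : 2 ≤ m)
    (F : Type*) [Field F] [Fintype F] (hF : Fintype.card F = 2 ^ k)
    (n : ℕ) (hn3 : 3 ≤ n) (hn : n ≤ 2 * m + 1) :
    ∃ ρ : Fin n → Matrix.symplecticGroup (Fin m) F, IsStringCGroupRep ρ := by
  have : CharP F 2 := charP_of_card_eq_prime_pow hF
  have heven : Even (Fintype.card F) := hF ▸ (even_two.pow_of_ne_zero (by omega))
  have h4 : 4 ≤ Fintype.card F := hF ▸ Nat.pow_le_pow_right two_pos hk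
  obtain ⟨b, hb0, hb1, hb, hb2⟩ := IsFullRotation.exists_isFullRotation heven h4
  obtain ⟨ρ, hρ⟩ := IsOddStringCGroup.exists_of_le hn3 hn
    ((SymplecticChain.isTransvectionChain hb0 hb1 hb hb2 h4).isOddStringCGroup (m := m) (by omega))
  exact ⟨_, hρ.isStringCGroupRep (by omega)⟩
end

section
/- Let (G; (ρ_0, …, ρ_{n−1})) be an irreducible string C-group representation of rank n ≥ 4 of a group G, with Schläfli type (p_1, …, p_{n−1}). Suppose t ∈ {0, …, n−3} is such that p_{2+i} is odd for every i ∈ {0, …, t}. Then for each i ∈ {0, …, t}, the group G has a string C-group representation of rank n−i. -/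
open Subgroup

/-- Products of elements from two elementwise commuting sets exhaust the subgroup they generate. -/
theorem exists_mul_of_mem_closure_union {G : Type*} [Group G] {A B : Set G}
    (hAB : ∀ a ∈ A, ∀ b ∈ B, Commute a b) {x : G} (hx : x ∈ closure (A ∪ B)) :
    ∃ a ∈ closure A, ∃ b ∈ closure B, x = a * b := by
  have hcomm : ∀ a ∈ closure A, ∀ b ∈ closure B, a * b = b * a := by
    have h1 : closure A ≤ centralizer (closure B : Set G) := by
      rw [centralizer_closure, closure_le]
      intro a ha
      simp only [SetLike.mem_coe, mem_centralizer_iff]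
      exact fun b hb => (hAB a ha b hb).eq.symm
    exact fun a ha b hb => (mem_centralizer_iff.1 (h1 ha) b hb).symm
  induction hx using closure_induction with
  | mem x hx =>
    rcases hx with hx | hx
    · exact ⟨x, subset_closure hx, 1, one_mem _, by simp⟩
    · exact ⟨1, one_mem _, x, subset_closure hx, by simp⟩
  | one => exact ⟨1, one_mem _, 1, one_mem _, by simp⟩
  | mul x y _ _ hx hy =>
    obtain ⟨a, ha, b, hb, rfl⟩ := hx
    obtain ⟨a', ha', b', hb', rfl⟩ := hy
    refine ⟨a * a', mul_mem ha ha', b * b', mul_mem hb hb', ?_⟩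
    rw [mul_assoc, ← mul_assoc b, ← hcomm a' ha' b hb]
    simp only [mul_assoc]
  | inv x _ hx =>
    obtain ⟨a, ha, b, hb, rfl⟩ := hx
    exact ⟨a⁻¹, inv_mem ha, b⁻¹, inv_mem hb, by
      rw [hcomm a ha b hb, mul_inv_rev]⟩

/-- Elements of a group generated by two involutions are rotations or reflections. -/
theorem exists_zpow_of_mem_closure_pair {G : Type*} [Group G] {s b : G}
    (hs : s * s = 1) (hb : b * b = 1) {x : G} (hx : x ∈ closure {s, b}) :
    ∃ k : ℤ, x = (s * b) ^ k ∨ x = (s * b) ^ k * s := by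
  have hsi : s⁻¹ = s := inv_eq_of_mul_eq_one_left hs
  have hbi : b⁻¹ = b := inv_eq_of_mul_eq_one_left hb
  have step_s : ∀ x : G, (∃ k : ℤ, x = (s * b) ^ k ∨ x = (s * b) ^ k * s) →
      ∃ k : ℤ, x * s = (s * b) ^ k ∨ x * s = (s * b) ^ k * s := by
    rintro x ⟨k, rfl | rfl⟩
    · exact ⟨k, Or.inr rfl⟩
    · exact ⟨k, Or.inl (by rw [mul_assoc, hs, mul_one])⟩
  have step_b : ∀ x : G, (∃ k : ℤ, x = (s * b) ^ k ∨ x = (s * b) ^ k * s) →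
      ∃ k : ℤ, x * b = (s * b) ^ k ∨ x * b = (s * b) ^ k * s := by
    rintro x ⟨k, rfl | rfl⟩
    · refine ⟨k - 1, Or.inr ?_⟩
      rw [zpow_sub_one, mul_inv_rev, hsi, hbi, mul_assoc, mul_assoc, hs, mul_one]
    · exact ⟨k + 1, Or.inl (by rw [zpow_add_one, mul_assoc])⟩
  induction hx using closure_induction_right with
  | one => exact ⟨0, Or.inl (by simp)⟩
  | mul_right x _ y hy ih =>
    rcases hy with rfl | rfl
    · exact step_s x ih
    · exact step_b x ih
  | mul_inv_cancel x _ y hy ih =>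
    rcases hy with rfl | rfl
    · rw [hsi]; exact step_s x ih
    · rw [hbi]; exact step_b x ih

theorem not_mem_closure_mul_pair {G : Type*} [Group G] {a b c : G} (ha : a * a = 1)
    (hb : b * b = 1) (hc : c * c = 1) (hac : Commute a c) (hab : ¬ Commute a b)
    (hcb : ¬ Commute c b) : a ∉ closure {a * c, b} := by
  intro hmem
  have hs : (a * c) * (a * c) = 1 := by
    rw [hac.symm.mul_mul_mul_comm, ha, hc, one_mul]
  have hb' : b = (a * c) * ((a * c) * b) := by rw [← mul_assoc, hs, one_mul]
  have key : ∀ y : G, Commute y (a * c) → ∀ k : ℤ, y = (a * c * b) ^ k → Commute y b := by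
    intro y hy k hk
    rw [hb']
    refine hy.mul_right ?_
    nth_rewrite 1 [hk]
    exact Commute.zpow_self _ _
  obtain ⟨k, hk | hk⟩ := exists_zpow_of_mem_closure_pair hs hb hmem
  · exact hab (key a ((Commute.refl a).mul_right hac) k hk)
  · refine hcb (key c (hac.symm.mul_right (Commute.refl c)) k ?_)
    calc c = a * (a * c) := by rw [← mul_assoc, ha, one_mul]
      _ = (a * c * b) ^ k * (a * c) * (a * c) := by rw [← hk]
      _ = _ := by rw [mul_assoc, hs, mul_one]

/-- For commuting involutions `a`, `c`, neither commuting with the involution `b`, the Klein group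
generated by `a`, `c` meets the dihedral group generated by `a * c`, `b` only in `⟨a * c⟩`. -/
theorem mem_closure_mul_of_mem_closure_pair {G : Type*} [Group G] {a b c : G} (ha : a * a = 1)
    (hb : b * b = 1) (hc : c * c = 1) (hac : Commute a c) (hab : ¬ Commute a b)
    (hcb : ¬ Commute c b) {x : G} (hx : x ∈ closure {a * c, b}) (hx' : x ∈ closure {a, c}) :
    x ∈ closure {a * c} := by
  have hklein : x = 1 ∨ x = a ∨ x = c ∨ x = a * c := by
    have hs : (a * c) * (a * c) = 1 := by
      rw [hac.symm.mul_mul_mul_comm, ha, hc, one_mul]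
    obtain ⟨k, hk⟩ := exists_zpow_of_mem_closure_pair ha hc hx'
    have hz : (a * c) ^ k = 1 ∨ (a * c) ^ k = a * c := by
      rcases Int.even_or_odd' k with ⟨l, rfl | rfl⟩
      · left; rw [zpow_mul, zpow_two, hs, one_zpow]
      · right; rw [zpow_add_one, zpow_mul, zpow_two, hs, one_zpow, one_mul]
    have hca : a * c * a = c := by rw [hac.eq, mul_assoc, ha, mul_one]
    rcases hz with hz | hz <;> rw [hz] at hk <;> simp only [one_mul, hca] at hk <;> tauto
  rcases hklein with rfl | rfl | rfl | rfl
  · exact one_mem _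
  · exact absurd hx (not_mem_closure_mul_pair ha hb hc hac hab hcb)
  · rw [hac.eq] at hx
    exact absurd hx (not_mem_closure_mul_pair hc hb ha hac.symm hcb hab)
  · exact subset_closure rfl

/-- An involution commuting with `b` and `c` lies in the group generated by `a * b` and `c` when
`b * c` has odd order. -/
theorem mem_closure_mul_pair_of_odd {G : Type*} [Group G] {a b c : G} (ha : a * a = 1)
    (hab : Commute a b) (hac : Commute a c) (hodd : Odd (orderOf (b * c))) :
    a ∈ closure {a * b, c} := by
  have hpow : (a * b * c) ^ orderOf (b * c) = a := by
    rw [mul_assoc, (hab.mul_right hac).mul_pow, pow_orderOf_eq_one, mul_one]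
    obtain ⟨k, hk⟩ := hodd
    rw [hk, pow_succ, pow_mul, pow_two, ha, one_pow, one_mul]
  have := pow_mem (mul_mem (subset_closure (by simp) : a * b ∈ closure {a * b, c})
    (subset_closure (by simp) : c ∈ closure {a * b, c})) (orderOf (b * c))
  rwa [hpow] at this

/-- The generators `ρ₁, ρ₀ρ₂, ρ₃, ρ₄, …`. -/
def reducedGens {G : Type*} [Group G] {m : ℕ} (ρ : Fin (m + 4) → G) : Fin (m + 3) → G :=
  Fin.cons (ρ 1) (Fin.cons (ρ 0 * ρ 2) fun i : Fin (m + 1) => ρ i.succ.succ.succ)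

/-- The index of the reduced generator in which an original generator occurs. -/
def reducedIndex {m : ℕ} : Fin (m + 4) → Fin (m + 3) :=
  Fin.cons 1 (Fin.cons 0 (Fin.cons 1 fun i : Fin (m + 1) => i.succ.succ))

namespace IsStringCGroupRep

section

variable {G : Type*} [Group G] {n : ℕ} {ρ : Fin n → G}

theorem mul_self (h : IsStringCGroupRep ρ) (i : Fin n) : ρ i * ρ i = 1 := by
  rw [← pow_two, ← h.1 i, pow_orderOf_eq_one]

theorem ne_one (h : IsStringCGroupRep ρ) (i : Fin n) : ρ i ≠ 1 := by
  intro h1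
  have := h.1 i
  simp [h1] at this

theorem commute (h : IsStringCGroupRep ρ) {i j : Fin n} (hij : i.val + 1 < j.val) :
    Commute (ρ i) (ρ j) := h.2.2.1 i j hij

theorem mem_closure_inter (h : IsStringCGroupRep ρ) {I J : Set (Fin n)} {x : G}
    (hI : x ∈ closure (ρ '' I)) (hJ : x ∈ closure (ρ '' J)) : x ∈ closure (ρ '' (I ∩ J)) := by
  rw [← h.2.2.2]; exact ⟨hI, hJ⟩

theorem ne_of_ne (h : IsStringCGroupRep ρ) {i j : Fin n} (hij : i ≠ j) : ρ i ≠ ρ j := by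
  intro he
  have hi : ρ i ∈ closure (ρ '' {i}) := subset_closure ⟨i, rfl, rfl⟩
  have hj : ρ i ∈ closure (ρ '' {j}) := subset_closure ⟨j, rfl, he.symm⟩
  have := h.mem_closure_inter hi hj
  rw [Set.singleton_inter_eq_empty.2 (by simpa using hij)] at this
  simp only [Set.image_empty, Subgroup.closure_empty, mem_bot] at this
  exact h.ne_one i this

end

section

variable {G : Type*} [Group G] {m : ℕ} {ρ : Fin (m + 4) → G}

theorem reducedGens_mem (ρ : Fin (m + 4) → G) {J : Set (Fin (m + 3))} {i : Fin (m + 3)}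
    (hi : i ∈ J) : reducedGens ρ i ∈ closure (ρ '' (reducedIndex ⁻¹' J)) := by
  have hgen : ∀ x, reducedIndex x ∈ J → ρ x ∈ closure (ρ '' (reducedIndex ⁻¹' J)) :=
    fun x hx => subset_closure ⟨x, hx, rfl⟩
  induction i using Fin.cases with
  | zero => exact hgen 1 hi
  | succ i =>
    induction i using Fin.cases with
    | zero => exact mul_mem (hgen 0 hi) (hgen 2 hi)
    | succ i => exact hgen i.succ.succ.succ hi

theorem closure_reducedGens_le (ρ : Fin (m + 4) → G) (J : Set (Fin (m + 3))) :
    closure (reducedGens ρ '' J) ≤ closure (ρ '' (reducedIndex ⁻¹' J)) := by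
  rw [closure_le]
  rintro _ ⟨i, hi, rfl⟩
  exact reducedGens_mem ρ hi

theorem closure_reducedGens_eq (h : IsStringCGroupRep ρ) (hodd : Odd (orderOf (ρ 2 * ρ 3)))
    {J : Set (Fin (m + 3))} (hJ : 1 ∈ J → 2 ∈ J) :
    closure (reducedGens ρ '' J) = closure (ρ '' (reducedIndex ⁻¹' J)) := by
  refine le_antisymm (closure_reducedGens_le ρ J) ?_
  have hgen : ∀ i ∈ J, reducedGens ρ i ∈ closure (reducedGens ρ '' J) :=
    fun i hi => subset_closure ⟨i, hi, rfl⟩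
  have hzero : 1 ∈ J → ρ 0 ∈ closure (reducedGens ρ '' J) := by
    intro h1
    have := mem_closure_mul_pair_of_odd (h.mul_self 0)
      (h.commute (i := 0) (j := 2) (Nat.lt_add_one 1))
      (h.commute (i := 0) (j := 3) (Nat.lt_add_of_pos_right Nat.two_pos)) hodd
    refine (closure_le _).2 ?_ this
    rintro _ (rfl | rfl)
    · exact hgen 1 h1
    · exact hgen 2 (hJ h1)
  rw [closure_le]
  rintro _ ⟨x, hx, rfl⟩
  induction x using Fin.cases with
  | zero => exact hzero hx
  | succ x =>
    induction x using Fin.cases with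
    | zero => exact hgen 0 hx
    | succ x =>
      induction x using Fin.cases with
      | zero =>
        have := mul_mem (hzero hx) (hgen 1 hx)
        have he : ρ 0 * reducedGens ρ 1 = ρ 2 := by
          change ρ 0 * (ρ 0 * ρ 2) = ρ 2
          rw [← mul_assoc, h.mul_self, one_mul]
        rwa [he] at this
      | succ x => exact hgen x.succ.succ hx

theorem reducedGens_commute (h : IsStringCGroupRep ρ) {i j : Fin (m + 3)}
    (hij : i.val + 1 < j.val) : Commute (reducedGens ρ i) (reducedGens ρ j) := by
  induction j using Fin.cases with
  | zero => simp at hij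
  | succ j =>
    induction j using Fin.cases with
    | zero => simp at hij
    | succ j =>
      induction i using Fin.cases with
      | zero => exact h.commute (i := 1) (j := j.succ.succ.succ) (by simp)
      | succ i =>
        simp only [Fin.val_succ] at hij
        induction i using Fin.cases with
        | zero =>
          have h0 := h.commute (i := 0) (j := j.succ.succ.succ) (by simp)
          refine h0.mul_left (h.commute (i := 2) (j := j.succ.succ.succ) ?_)
          simp only [Fin.val_succ, Fin.val_two, Fin.val_zero] at hij ⊢
          omega
        | succ i =>
          simp only [Fin.val_succ] at hij
          refine h.commute (i := i.succ.succ.succ) (j := j.succ.succ.succ) ?_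
          simp only [Fin.val_succ]
          omega

/-- If `2 ∉ J`, the generators with index at most `1` are separated from those with index at
least `3`. -/
theorem eq_union_of_two_not_mem {J : Set (Fin (m + 3))} (hJ : (2 : Fin (m + 3)) ∉ J) :
    J = (J ∩ {0, 1}) ∪ (J ∩ {i | 3 ≤ i.val}) := by
  ext i
  constructor
  · intro hi
    have h2 : i.val ≠ 2 := fun h2 => hJ (by
      have : i = 2 := Fin.ext h2
      rwa [← this])
    by_cases h3 : 3 ≤ i.val
    · exact Or.inr ⟨hi, h3⟩
    · refine Or.inl ⟨hi, ?_⟩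
      simp only [Set.mem_insert_iff, Set.mem_singleton_iff, Fin.ext_iff, Fin.val_zero, Fin.val_one]
      omega
  · rintro (hi | hi) <;> exact hi.1

theorem commute_of_reducedIndex (h : IsStringCGroupRep ρ) {x y : Fin (m + 4)}
    (hx : reducedIndex x ∈ ({0, 1} : Set (Fin (m + 3)))) (hy : 3 ≤ (reducedIndex y).val) :
    Commute (ρ x) (ρ y) := by
  have hx' : x.val ≤ 2 := by
    induction x using Fin.cases with
    | zero => simp
    | succ x =>
      induction x using Fin.cases with
      | zero => simp
      | succ x =>
        induction x using Fin.cases with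
        | zero => exact le_rfl
        | succ x =>
          change x.succ.succ ∈ ({0, 1} : Set (Fin (m + 3))) at hx
          rcases hx with hx | hx <;> cases congrArg Fin.val hx
  have hy' : 4 ≤ y.val := by
    induction y using Fin.cases with
    | zero => change 3 ≤ ((1 : Fin (m + 3))).val at hy; simp at hy
    | succ y =>
      induction y using Fin.cases with
      | zero => change 3 ≤ ((0 : Fin (m + 3))).val at hy; simp at hy
      | succ y =>
        induction y using Fin.cases with
        | zero => change 3 ≤ ((1 : Fin (m + 3))).val at hy; simp at hy
        | succ y =>
          change 3 ≤ y.succ.succ.val at hy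
          simp only [Fin.val_succ] at hy ⊢
          omega
  exact h.commute (by omega)

theorem mem_closure_reducedGens_low (h : IsStringCGroupRep ρ) (h01 : ¬ Commute (ρ 0) (ρ 1))
    (h21 : ¬ Commute (ρ 2) (ρ 1)) (hodd : Odd (orderOf (ρ 2 * ρ 3)))
    {L : Set (Fin (m + 3))} (hL : L ⊆ {0, 1}) {x : G}
    (hx : x ∈ closure (reducedGens ρ '' {0, 1}))
    (hx' : x ∈ closure (ρ '' (reducedIndex ⁻¹' L))) : x ∈ closure (reducedGens ρ '' L) := by
  by_cases h1 : 1 ∈ L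
  · by_cases h0 : 0 ∈ L
    · refine closure_mono (Set.image_mono ?_) hx
      rintro _ (rfl | rfl) <;> assumption
    · have hL1 : L = {1} := by
        ext i
        refine ⟨fun hi => ?_, fun hi => by rw [hi]; exact h1⟩
        rcases hL hi with rfl | hi'
        · exact absurd hi h0
        · exact hi'
      subst hL1
      have hpre : (reducedIndex ⁻¹' {1} : Set (Fin (m + 4))) ⊆ {0, 2} := by
        intro y hy
        induction y using Fin.cases with
        | zero => exact Or.inl rfl
        | succ y =>
          induction y using Fin.cases with
          | zero =>
            change (0 : Fin (m + 3)) = 1 at hy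
            simp at hy
          | succ y =>
            induction y using Fin.cases with
            | zero => exact Or.inr rfl
            | succ y =>
              change y.succ.succ = 1 at hy
              cases congrArg Fin.val hy
      rw [Set.image_singleton]
      refine mem_closure_mul_of_mem_closure_pair (h.mul_self 0) (h.mul_self 1) (h.mul_self 2)
        (h.commute (i := 0) (j := 2) (Nat.lt_add_one 1)) h01 h21 ?_ ?_
      · rw [Set.image_pair, Set.pair_comm] at hx
        exact hx
      · have := closure_mono (Set.image_mono hpre) hx'
        rwa [Set.image_pair] at this
  · rw [h.closure_reducedGens_eq hodd fun hm => absurd hm h1]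
    exact hx'

theorem mem_closure_reducedGens_inter (h : IsStringCGroupRep ρ) (h01 : ¬ Commute (ρ 0) (ρ 1))
    (h21 : ¬ Commute (ρ 2) (ρ 1)) (hodd : Odd (orderOf (ρ 2 * ρ 3)))
    {J K : Set (Fin (m + 3))} (hJ2 : (2 : Fin (m + 3)) ∉ J) {x : G}
    (hJ : x ∈ closure (reducedGens ρ '' J)) (hK : x ∈ closure (reducedGens ρ '' K)) :
    x ∈ closure (reducedGens ρ '' (J ∩ K)) := by
  have hI : x ∈ closure (ρ '' (reducedIndex ⁻¹' (J ∩ K))) :=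
    h.mem_closure_inter (closure_reducedGens_le ρ J hJ) (closure_reducedGens_le ρ K hK)
  have hI2 : (2 : Fin (m + 3)) ∉ J ∩ K := fun hm => hJ2 hm.1
  rw [eq_union_of_two_not_mem hI2, Set.preimage_union, Set.image_union] at hI
  rw [eq_union_of_two_not_mem hJ2, Set.image_union] at hJ
  obtain ⟨d, hd, r, hr, rfl⟩ := exists_mul_of_mem_closure_union (by
    rintro _ ⟨i, hi, rfl⟩ _ ⟨j, hj, rfl⟩
    refine h.reducedGens_commute ?_
    have hj3 : 3 ≤ j.val := hj.2
    rcases hi.2 with rfl | hi'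
    · simp only [Fin.val_zero]; omega
    · rw [Set.mem_singleton_iff.1 hi']; simp only [Fin.val_one]; omega) hJ
  obtain ⟨d', hd', r', hr', he⟩ := exists_mul_of_mem_closure_union (by
    rintro _ ⟨i, hi, rfl⟩ _ ⟨j, hj, rfl⟩
    exact h.commute_of_reducedIndex hi.2 hj.2) hI
  have hlow : d'⁻¹ * d ∈ closure (ρ '' (reducedIndex ⁻¹' {0, 1})) := by
    refine mul_mem (inv_mem ?_) ?_
    · exact closure_mono (Set.image_mono (Set.preimage_mono Set.inter_subset_right)) hd'
    · exact closure_mono (Set.image_mono (Set.preimage_mono Set.inter_subset_right))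
        (closure_reducedGens_le ρ _ hd)
  have hhigh : d'⁻¹ * d ∈ closure (ρ '' (reducedIndex ⁻¹' {i | 3 ≤ i.val})) := by
    have hdr : d'⁻¹ * d = r' * r⁻¹ := by
      rw [eq_mul_inv_iff_mul_eq, mul_assoc, he, inv_mul_cancel_left]
    rw [hdr]
    refine mul_mem ?_ (inv_mem ?_)
    · exact closure_mono (Set.image_mono (Set.preimage_mono Set.inter_subset_right)) hr'
    · exact closure_mono (Set.image_mono (Set.preimage_mono Set.inter_subset_right))
        (closure_reducedGens_le ρ _ hr)
  have hdd : d' = d := by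
    have := h.mem_closure_inter hlow hhigh
    rw [← Set.preimage_inter] at this
    have hempty : ({0, 1} ∩ {i | 3 ≤ i.val} : Set (Fin (m + 3))) = ∅ := by
      ext i
      simp only [Set.mem_inter_iff, Set.mem_insert_iff, Set.mem_singleton_iff, Fin.ext_iff,
        Fin.val_zero, Fin.val_one, Set.mem_ofPred_eq, Set.mem_empty_iff_false, iff_false]
      omega
    rw [hempty, Set.preimage_empty, Set.image_empty, Subgroup.closure_empty, mem_bot] at this
    exact inv_mul_eq_one.1 this
  subst hdd
  obtain rfl : r = r' := mul_left_cancel he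
  refine mul_mem ?_ ?_
  · refine closure_mono (Set.image_mono Set.inter_subset_left)
      (h.mem_closure_reducedGens_low h01 h21 hodd Set.inter_subset_right ?_ hd')
    exact closure_mono (Set.image_mono Set.inter_subset_right) hd
  · rw [← h.closure_reducedGens_eq hodd (by
      intro hm
      have := hm.2
      simp at this)] at hr'
    exact closure_mono (Set.image_mono Set.inter_subset_left) hr'

/-- The rank reduction step: replacing `ρ₀, ρ₁, ρ₂, ρ₃, …` by `ρ₁, ρ₀ρ₂, ρ₃, …`. -/
theorem isStringCGroupRep_reducedGens (h : IsStringCGroupRep ρ) (h01 : ¬ Commute (ρ 0) (ρ 1))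
    (h21 : ¬ Commute (ρ 2) (ρ 1)) (hodd : Odd (orderOf (ρ 2 * ρ 3))) :
    IsStringCGroupRep (reducedGens ρ) := by
  refine ⟨fun i => ?_, ?_, fun i j => h.reducedGens_commute, fun J K => le_antisymm ?_ ?_⟩
  · induction i using Fin.cases with
    | zero => exact h.1 1
    | succ i =>
      induction i using Fin.cases with
      | zero =>
        change orderOf (ρ 0 * ρ 2) = 2
        have h02 : Commute (ρ 0) (ρ 2) := h.commute (Nat.lt_add_one 1)
        refine orderOf_eq_prime ?_ fun he => ?_
        · rw [h02.mul_pow, pow_two, pow_two, h.mul_self, h.mul_self, one_mul]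
        · have hne : ρ 0 ≠ ρ 2 := h.ne_of_ne fun he => by cases congrArg Fin.val he
          exact hne (mul_right_cancel (he.trans (h.mul_self 2).symm))
      | succ i => exact h.1 i.succ.succ.succ
  · rw [← Set.image_univ, h.closure_reducedGens_eq hodd fun _ => Set.mem_univ _,
      Set.preimage_univ, Set.image_univ]
    exact h.2.1
  · rintro x ⟨hJ, hK⟩
    by_cases hJ2 : (2 : Fin (m + 3)) ∈ J
    · by_cases hK2 : (2 : Fin (m + 3)) ∈ K
      · rw [h.closure_reducedGens_eq hodd (J := J ∩ K) fun _ => ⟨hJ2, hK2⟩]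
        exact h.mem_closure_inter (closure_reducedGens_le ρ J hJ) (closure_reducedGens_le ρ K hK)
      · rw [Set.inter_comm]
        exact h.mem_closure_reducedGens_inter h01 h21 hodd hK2 hK hJ
    · exact h.mem_closure_reducedGens_inter h01 h21 hodd hJ2 hJ hK
  · exact le_inf (closure_mono (Set.image_mono Set.inter_subset_left))
      (closure_mono (Set.image_mono Set.inter_subset_right))

theorem not_commute_reducedGens_zero_one (h : IsStringCGroupRep ρ)
    (h01 : ¬ Commute (ρ 0) (ρ 1)) : ¬ Commute (ρ 0 * ρ 2) (ρ 1) := by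
  intro hc
  have hinv : ∀ i, (ρ i)⁻¹ = ρ i := fun i => inv_eq_of_mul_eq_one_left (h.mul_self i)
  have he : ρ 0 * ρ 1 * ρ 0 * ρ 1 = ρ 2 * ρ 1 * ρ 2 * ρ 1 := by
    have h02 : Commute (ρ 0) (ρ 2) := h.commute (Nat.lt_add_one 1)
    have hc' : ρ 0 * ρ 2 * ρ 1 = ρ 1 * (ρ 0 * ρ 2) := hc.eq
    calc ρ 0 * ρ 1 * ρ 0 * ρ 1 = ρ 0 * (ρ 1 * (ρ 0 * ρ 2)) * ρ 2 * ρ 1 := by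
          simp only [mul_assoc]
          rw [← mul_assoc (ρ 2) (ρ 2), h.mul_self, one_mul]
      _ = ρ 2 * ρ 1 * ρ 2 * ρ 1 := by
          rw [← hc']
          simp only [← mul_assoc]
          rw [h.mul_self, one_mul]
  have hmem : ρ 0 * ρ 1 * ρ 0 * ρ 1 ∈ closure (ρ '' ({0, 1} ∩ {1, 2})) := by
    have hgen : ∀ (I : Set (Fin (m + 4))), ∀ i ∈ I, ρ i ∈ closure (ρ '' I) :=
      fun I i hi => subset_closure ⟨i, hi, rfl⟩
    refine h.mem_closure_inter ?_ ?_
    · have h0 := hgen {0, 1} 0 (by simp)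
      have h1 := hgen {0, 1} 1 (by simp)
      exact mul_mem (mul_mem (mul_mem h0 h1) h0) h1
    · rw [he]
      have h1 := hgen {1, 2} 1 (by simp)
      have h2 := hgen {1, 2} 2 (by simp)
      exact mul_mem (mul_mem (mul_mem h2 h1) h2) h1
  have hsub : ({0, 1} ∩ {1, 2} : Set (Fin (m + 4))) ⊆ {1} := by
    rintro i ⟨rfl | hi, hi'⟩
    · rcases hi' with hi' | hi' <;> cases congrArg Fin.val hi'
    · exact hi
  replace hmem := closure_mono (Set.image_mono hsub) hmem
  rw [Set.image_singleton, mem_closure_singleton] at hmem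
  obtain ⟨k, hk⟩ := hmem
  have hcomm : Commute (ρ 0 * ρ 1 * ρ 0) (ρ 1) := by
    have : ρ 0 * ρ 1 * ρ 0 = ρ 1 ^ k * (ρ 1)⁻¹ := by rw [hk, mul_inv_cancel_right]
    rw [this]
    exact ((Commute.refl _).zpow_left k).mul_left (Commute.refl _).inv_left
  have hpow : ρ 1 ^ k = 1 ∨ ρ 1 ^ k = ρ 1 := by
    rcases Int.even_or_odd' k with ⟨l, rfl | rfl⟩
    · left; rw [zpow_mul, zpow_two, h.mul_self, one_zpow]
    · right; rw [zpow_add_one, zpow_mul, zpow_two, h.mul_self, one_zpow, one_mul]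
  rcases hpow with hp | hp
  · refine h01 ?_
    rw [hp, mul_assoc, eq_comm, mul_eq_one_iff_eq_inv, mul_inv_rev, hinv, hinv] at hk
    exact hk
  · rw [hp, eq_comm, mul_eq_right, mul_eq_one_iff_eq_inv, hinv, mul_eq_left] at hk
    exact h.ne_one 1 hk

end

/-- Iterating the rank reduction step. -/
theorem exists_rank_sub {G : Type*} [Group G] (i m : ℕ) (ρ : Fin (m + i + 3) → G)
    (h : IsStringCGroupRep ρ) (h01 : ¬ Commute (ρ 0) (ρ 1)) (h21 : ¬ Commute (ρ 2) (ρ 1))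
    (hodd : ∀ (k : ℕ) (hk : k < i),
      Odd (orderOf (ρ ⟨k + 2, by omega⟩ * ρ ⟨k + 3, by omega⟩))) :
    ∃ σ : Fin (m + 3) → G, IsStringCGroupRep σ := by
  induction i with
  | zero => exact ⟨ρ, h⟩
  | succ i ih =>
    change Fin ((m + i) + 4) → G at ρ
    have hodd0 : Odd (orderOf (ρ 2 * ρ 3)) := hodd 0 (by omega)
    refine ih (reducedGens ρ) (h.isStringCGroupRep_reducedGens h01 h21 hodd0) (fun hc => ?_) (fun hc => ?_)
      fun k hk => hodd (k + 1) (by omega)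
    · exact h.not_commute_reducedGens_zero_one h01 hc.symm
    · change Commute (ρ 3) (ρ 0 * ρ 2) at hc
      have h03 : Commute (ρ 0) (ρ 3) := h.commute (Nat.lt_add_of_pos_right Nat.two_pos)
      have h32 : Commute (ρ 3) (ρ 2) := by
        have := h03.symm.mul_right hc
        rwa [← mul_assoc, h.mul_self, one_mul] at this
      have hsq : (ρ 2 * ρ 3) ^ 2 = 1 := by
        rw [h32.symm.mul_pow, pow_two, pow_two, h.mul_self, h.mul_self, one_mul]
      have hone : ρ 2 * ρ 3 = 1 := by
        rw [← orderOf_eq_one_iff]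
        refine Nat.dvd_one.1 ?_
        rw [← (Nat.coprime_two_right.2 hodd0).gcd_eq_one]
        exact Nat.dvd_gcd dvd_rfl (orderOf_dvd_of_pow_eq_one hsq)
      have hne : ρ 2 ≠ ρ 3 := h.ne_of_ne fun he => by cases congrArg Fin.val he
      exact hne (mul_right_cancel (hone.trans (h.mul_self 3).symm))

theorem not_commute {G : Type*} [Group G] {n : ℕ} {ρ : Fin n → G} (h : IsStringCGroupRep ρ)
    {i j : Fin n} (hij : i ≠ j) (h2 : orderOf (ρ i * ρ j) ≠ 2) : ¬ Commute (ρ i) (ρ j) := by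
  intro hc
  refine h2 (orderOf_eq_prime ?_ fun he => ?_)
  · rw [hc.mul_pow, pow_two, pow_two, h.mul_self, h.mul_self, one_mul]
  · exact h.ne_of_ne hij (mul_right_cancel (he.trans (h.mul_self j).symm))

end IsStringCGroupRep

/-- If `(G; (ρ₀, …, ρ_{n-1}))` is an irreducible string C-group representation of
rank `n ≥ 4` whose Schläfli entries `p_{2+i}` are odd for all `i ∈ {0, …, t}`
(where `t ≤ n - 3`), then `G` has a string C-group representation of rank `n - i`
for each `i ∈ {0, …, t}`. -/
theorem rank_reduction_odd_sequence {G : Type*} [Group G] (n : ℕ) (hn : 4 ≤ n)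
    (ρ : Fin n → G) (h : IsStringCGroupRep ρ)
    (hirr : ∀ (i : ℕ) (hi : i + 1 < n), orderOf (ρ ⟨i, by omega⟩ * ρ ⟨i + 1, hi⟩) ≠ 2)
    (t : ℕ) (ht : t ≤ n - 3)
    (hodd : ∀ (i : ℕ) (hi : i ≤ t),
      Odd (orderOf (ρ ⟨1 + i, by omega⟩ * ρ ⟨2 + i, by omega⟩))) :
    ∀ (i : ℕ), i ≤ t → ∃ σ : Fin (n - i) → G, IsStringCGroupRep σ := by
  intro i hi
  obtain ⟨m, rfl⟩ : ∃ m, n = m + i + 3 := ⟨n - 3 - i, by omega⟩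
  have hrank : m + i + 3 - i = m + 3 := by omega
  rw [hrank]
  refine IsStringCGroupRep.exists_rank_sub i m ρ h ?_ (fun hc => ?_) fun k hk => ?_
  · exact h.not_commute (by simp) (hirr 0 (by omega))
  · exact h.not_commute (by simp) (hirr 1 (by omega)) hc.symm
  · have := hodd (1 + k) (by omega)
    have h2 : 1 + (1 + k) = k + 2 := by omega
    have h3 : 2 + (1 + k) = k + 3 := by omega
    simpa only [h2, h3] using this
end
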